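/- arXiv:0806.0024 — 3 statements merged into one kernel-verified Lean document; each statement's English description precedes it below -/
import Mathlib

section
/- Up to isomorphism of LATKes (a linear bijection preserving the trilinear bracket), there is exactly one finite-dimensional simple LATKe over ℂ: every finite-dimensional simple LATKe over ℂ is isomorphic to the four-dimensional LATKe L₃. -/
/-!
STATEMENT 0: Up to isomorphism of LATKes (a linear bijection preserving the
trilinear bracket), there is exactly one finite-dimensional simple LATKe over ℂ:
every finite-dimensional simple LATKe over ℂ is isomorphic to the
four-dimensional LATKe L₃ (the LATKe on ℂ⁴ whose bracket is the trilinear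
totally antisymmetric map determined by [e₁,e₂,e₃] = −e₄, [e₁,e₂,e₄] = e₃,
[e₁,e₃,e₄] = −e₂, [e₂,e₃,e₄] = e₁).
-/

/-- A trilinear bracket on `L`, encoded as iterated linear maps. -/
abbrev TriBracket (k L : Type*) [Field k] [AddCommGroup L] [Module k L] : Type _ :=
  L →ₗ[k] L →ₗ[k] L →ₗ[k] L

variable {k L : Type*} [Field k] [AddCommGroup L] [Module k L]

/-- Total antisymmetry of a trilinear bracket. -/
def IsAlt3 (b : TriBracket k L) : Prop :=
  (∀ x y z : L, b x y z = - b y x z) ∧ (∀ x y z : L, b x y z = - b x z y)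

/-- The Jacobi identity of the third kind. -/
def Jacobi3 (b : TriBracket k L) : Prop :=
  ∀ x y z₁ z₂ z₃ : L,
    b x y (b z₁ z₂ z₃)
      = b (b x y z₁) z₂ z₃ + b z₁ (b x y z₂) z₃ + b z₁ z₂ (b x y z₃)

/-- An ideal of a LATKe: a subspace `I` with `[L, L, I] ⊆ I`. -/
def IsLATKeIdeal (b : TriBracket k L) (I : Submodule k L) : Prop :=
  ∀ x y : L, ∀ z ∈ I, b x y z ∈ I

/-- A LATKe is simple if its bracket is not identically zero and its only
ideals are `⊥` and `⊤`. -/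
def IsSimpleLATKe (b : TriBracket k L) : Prop :=
  (∃ x y z : L, b x y z ≠ 0) ∧
    ∀ I : Submodule k L, IsLATKeIdeal b I → I = ⊥ ∨ I = ⊤

/-- The `i`-th standard basis vector of `ℂ⁴`. -/
noncomputable def E (i : Fin 4) : Fin 4 → ℂ := Pi.single i 1

/-- The defining values of the bracket of `L₃` on the standard basis:
`[e₁,e₂,e₃] = −e₄`, `[e₁,e₂,e₄] = e₃`, `[e₁,e₃,e₄] = −e₂`, `[e₂,e₃,e₄] = e₁`. -/
def L3Values (b : TriBracket ℂ (Fin 4 → ℂ)) : Prop :=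
  b (E 0) (E 1) (E 2) = - E 3 ∧ b (E 0) (E 1) (E 3) = E 2 ∧
  b (E 0) (E 2) (E 3) = - E 1 ∧ b (E 1) (E 2) (E 3) = E 0


namespace LATKeAux

open Module LieModule LieAlgebra

section Wt

variable {g : Type} [LieRing g] [LieAlgebra ℂ g]
variable (H : LieSubalgebra ℂ g)
variable (V : Type) [AddCommGroup V] [Module ℂ V] [LieRingModule g V] [LieModule ℂ g V]

/-- Simultaneous eigenspace of `H` acting on `V` with weight `χ`. -/
def Wt (χ : Dual ℂ H) : Submodule ℂ V where
  carrier := {z | ∀ h : H, ⁅(h : g), z⁆ = χ h • z}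
  add_mem' := by
    intro a b ha hb h
    rw [lie_add, ha h, hb h, smul_add]
  zero_mem' := by intro h; simp
  smul_mem' := by
    intro c a ha h
    rw [lie_smul, ha h, smul_comm]

variable {H V}

lemma mem_Wt {χ : Dual ℂ H} {z : V} : z ∈ Wt H V χ ↔ ∀ h : H, ⁅(h : g), z⁆ = χ h • z := Iff.rfl

lemma lie_mem_Wt {α χ : Dual ℂ H} {t : g} {z : V} (ht : t ∈ Wt H g α) (hz : z ∈ Wt H V χ) :
    ⁅t, z⁆ ∈ Wt H V (α + χ) := by
  intro h
  rw [leibniz_lie, ht h, hz h, smul_lie, lie_smul, ← add_smul]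
  rfl

lemma iSupIndep_Wt [FiniteDimensional ℂ V] [LieRing.IsNilpotent H] :
    iSupIndep (fun χ : Dual ℂ H => Wt H V χ) := by
  have h1 := LieModule.iSupIndep_genWeightSpace ℂ H V
  have h2 : iSupIndep (fun χ : H → ℂ => (genWeightSpace V χ).toSubmodule) :=
    LieSubmodule.iSupIndep_toSubmodule.mpr h1
  have h3 := h2.comp (f := fun χ : Dual ℂ H => (χ : H → ℂ)) DFunLike.coe_injective
  refine h3.mono fun χ z hz => ?_
  apply weightSpace_le_genWeightSpace V (χ : H → ℂ)
  rw [mem_weightSpace]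
  exact hz

end Wt

section Killing

variable {g : Type} [LieRing g] [LieAlgebra ℂ g] [FiniteDimensional ℂ g] [IsKilling ℂ g]
variable (H : LieSubalgebra ℂ g) [H.IsCartanSubalgebra]

lemma mem_Wt_iff_rootSpace {χ : Dual ℂ H} {t : g} : t ∈ Wt H g χ ↔ t ∈ rootSpace H χ := by
  constructor
  · intro hz
    apply weightSpace_le_genWeightSpace g (χ : H → ℂ)
    rw [mem_weightSpace]
    exact hz
  · intro ht h
    exact IsKilling.lie_eq_smul_of_mem_rootSpace ht h

lemma iSup_Wt_g : ⨆ χ : Dual ℂ H, Wt H g χ = ⊤ := by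
  have h1 : ⨆ χ : Weight ℂ H g, (genWeightSpace g χ).toSubmodule = ⊤ :=
    LieSubmodule.iSup_toSubmodule_eq_top.mpr (iSup_genWeightSpace_eq_top' ℂ H g)
  rw [eq_top_iff, ← h1]
  refine iSup_le fun χ => ?_
  refine le_trans ?_ (le_iSup _ χ.toLinear)
  intro t ht
  rw [mem_Wt_iff_rootSpace]
  exact ht

lemma mem_H_of_Wt_zero {t : g} (ht : t ∈ Wt H g 0) : t ∈ H := by
  rw [mem_Wt_iff_rootSpace] at ht
  have : t ∈ LieAlgebra.zeroRootSubalgebra ℂ g H := ht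
  rwa [LieAlgebra.zeroRootSubalgebra_eq_of_is_cartan] at this

/-- A nonzero functional with nontrivial root space. -/
def IsRt (α : Dual ℂ H) : Prop := α ≠ 0 ∧ Wt H g α ≠ ⊥

/-- The weight attached to a root functional. -/
def IsRt.weight {H : LieSubalgebra ℂ g} [H.IsCartanSubalgebra] {α : Dual ℂ H} (h : IsRt H α) : Weight ℂ H g where
  toFun := α
  genWeightSpace_ne_bot' := by
    intro h'
    apply h.2
    rw [eq_bot_iff]
    intro t ht
    rw [mem_Wt_iff_rootSpace] at ht
    have : t ∈ (genWeightSpace g (α : H → ℂ)) := ht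
    rw [h'] at this
    simpa using this

lemma exists_coroots : ∃ co : Dual ℂ H → H,
    (∀ α, IsRt H α → α (co α) = 2 ∧ ∃ e f : g, IsSl2Triple (co α : g) e f ∧
      e ∈ Wt H g α ∧ f ∈ Wt H g (-α) ∧ (∀ t ∈ Wt H g α, ∃ s : ℂ, t = s • e) ∧
      (∀ t ∈ Wt H g (-α), ∃ s : ℂ, t = s • f)) ∧
    (∀ α β, IsRt H α → IsRt H β → (β (co α) = -2 ∨ β (co α) = 0 ∨ β (co α) = 2) →
      (α (co β) = -2 ∨ α (co β) = 0 ∨ α (co β) = 2) →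
      (β (co α) = 0 ∧ α (co β) = 0) ∨ β = α ∨ β = -α) := by
  classical
  refine ⟨fun α => if h : IsRt H α then IsKilling.coroot h.weight else 0, ?_, ?_⟩
  · intro α hα
    simp only [hα, dif_pos]
    have hnz : hα.weight.IsNonZero := by
      intro h0
      apply hα.1
      ext h
      exact congrFun h0 h
    refine ⟨IsKilling.root_apply_coroot hnz, ?_⟩
    obtain ⟨h, e, f, ht, he, hf⟩ := IsKilling.exists_isSl2Triple_of_weight_isNonZero hnz
    have hh := ht.h_eq_coroot hnz he hf
    rw [hh] at ht
    refine ⟨e, f, ht, ?_, ?_, ?_, ?_⟩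
    · rw [mem_Wt_iff_rootSpace]; exact he
    · rw [mem_Wt_iff_rootSpace]; exact hf
    · intro t htt
      rw [mem_Wt_iff_rootSpace] at htt
      have h1 := IsKilling.finrank_rootSpace_eq_one hα.weight hnz
      obtain ⟨s, hs⟩ := (finrank_eq_one_iff_of_nonzero' (⟨e, he⟩ : rootSpace H hα.weight)
        (by simpa using ht.e_ne_zero)).mp h1 ⟨t, htt⟩
      exact ⟨s, by simpa using (congrArg Subtype.val hs).symm⟩
    · intro t htt
      rw [mem_Wt_iff_rootSpace] at htt
      have h1 := IsKilling.finrank_rootSpace_eq_one (-hα.weight) hnz.neg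
      obtain ⟨s, hs⟩ := (finrank_eq_one_iff_of_nonzero' (⟨f, hf⟩ : rootSpace H (-hα.weight : Weight ℂ H g))
        (by simpa using ht.f_ne_zero)).mp h1 ⟨t, htt⟩
      exact ⟨s, by simpa using (congrArg Subtype.val hs).symm⟩
  · intro α β hα hβ
    simp only [hα, hβ, dif_pos]
    have hnza : hα.weight.IsNonZero := by
      intro h0
      apply hα.1
      ext h
      exact congrFun h0 h
    have hnzb : hβ.weight.IsNonZero := by
      intro h0
      apply hβ.1
      ext h
      exact congrFun h0 h
    let i : H.root := ⟨hα.weight, by simpa using hnza⟩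
    let j : H.root := ⟨hβ.weight, by simpa using hnzb⟩
    let P := IsKilling.rootSystem H
    have e1 : β (IsKilling.coroot hα.weight) = (P.pairingIn ℤ j i : ℂ) := by
      have := P.algebraMap_pairingIn ℤ j i
      simp only [algebraMap_int_eq, eq_intCast] at this
      rw [this]; rfl
    have e2 : α (IsKilling.coroot hβ.weight) = (P.pairingIn ℤ i j : ℂ) := by
      have := P.algebraMap_pairingIn ℤ i j
      simp only [algebraMap_int_eq, eq_intCast] at this
      rw [this]; rfl
    rw [e1, e2]
    intro h1 h2
    by_cases hij : i = j
    · right; left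
      have : hα.weight = hβ.weight := congrArg Subtype.val hij
      ext h
      exact (congrArg (fun w : Weight ℂ H g => w h) this).symm
    by_cases hij' : P.root i = - P.root j
    · right; right
      ext h
      have := congrArg (fun w : Dual ℂ H => - w h) hij'
      simp at this
      exact this.symm
    left
    have h4 := P.coxeterWeightIn_ne_four ℤ hij hij'
    have h5 := P.coxeterWeightIn_mem_set_of_isCrystallographic i j
    have h6 := P.coxeterWeightIn_eq_zero_iff (i := i) (j := j)
    have h7 := P.coxeterWeightIn_eq_zero_iff (i := j) (j := i)
    simp only [RootPairing.coxeterWeightIn] at h4 h5 h6 h7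
    norm_cast at h1 h2 ⊢
    rcases h1 with h1 | h1 | h1 <;> rcases h2 with h2 | h2 | h2 <;> simp_all
end Killing

end LATKeAux


namespace LATKeAux

open Module LieModule LieAlgebra

section Sys

set_option linter.unusedSectionVars false

variable {g : Type} [LieRing g] [LieAlgebra ℂ g]
variable {V : Type} [AddCommGroup V] [Module ℂ V] [LieRingModule g V] [LieModule ℂ g V]

/-- The abstract structure of a simple LATKe `V` with its Lie algebra `g` of inner derivations. -/
structure Sys (D : V →ₗ[ℂ] V →ₗ[ℂ] g) : Prop where
  equiv : ∀ (t : g) (x y : V), ⁅t, D x y⁆ = D ⁅t, x⁆ y + D x ⁅t, y⁆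
  span : Submodule.span ℂ {t | ∃ x y, t = D x y} = ⊤
  skew : ∀ x y : V, D x y = - D y x
  alt : ∀ x y z : V, ⁅D x y, z⁆ = - ⁅D x z, y⁆
  irr : ∀ N : Submodule ℂ V, (∀ t : g, ∀ z ∈ N, ⁅t, z⁆ ∈ N) → N = ⊥ ∨ N = ⊤
  faith : ∀ t : g, (∀ z : V, ⁅t, z⁆ = 0) → t = 0
  nonz : ∃ x y z : V, ⁅D x y, z⁆ ≠ 0

variable {D : V →ₗ[ℂ] V →ₗ[ℂ] g}

lemma Sys.self (S : Sys D) (x : V) : D x x = 0 := by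
  have h := S.skew x x
  have h2 : (2 : ℂ) • D x x = 0 := by
    rw [two_smul]; nth_rewrite 1 [h]; simp
  simpa using h2

lemma Sys.self_right (S : Sys D) (x y : V) : ⁅D x y, y⁆ = 0 := by
  have h := S.alt x y y
  have h2 : (2 : ℂ) • ⁅D x y, y⁆ = 0 := by
    rw [two_smul]; nth_rewrite 1 [h]; simp
  simpa using h2

lemma Sys.self_left (S : Sys D) (x y : V) : ⁅D x y, x⁆ = 0 := by
  rw [S.skew, neg_lie, S.self_right, neg_zero]

/-- cyclic invariance -/
lemma Sys.cyc (S : Sys D) (x y z : V) : ⁅D x y, z⁆ = ⁅D y z, x⁆ := by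
  rw [S.skew x y, neg_lie, S.alt y x z, neg_neg]

variable {H : LieSubalgebra ℂ g}

lemma Sys.D_mem (S : Sys D) {a c : Dual ℂ H} {x y : V} (hx : x ∈ Wt H V a) (hy : y ∈ Wt H V c) :
    D x y ∈ Wt H g (a + c) := by
  intro h
  rw [S.equiv, hx h, hy h]
  simp [add_smul]

variable [FiniteDimensional ℂ g] [FiniteDimensional ℂ V] [IsKilling ℂ g] [H.IsCartanSubalgebra]

lemma Sys.nontriv (S : Sys D) : Nontrivial V := by
  obtain ⟨x, y, z, h⟩ := S.nonz
  exact ⟨⟨_, _, h⟩⟩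

lemma Sys.iSup_Wt (S : Sys D) : ⨆ χ : Dual ℂ H, Wt H V χ = ⊤ := by
  have := S.nontriv
  refine (S.irr _ ?_).resolve_left ?_
  · intro t z hz
    have ht : t ∈ ⨆ χ : Dual ℂ H, Wt H g χ := by rw [iSup_Wt_g]; trivial
    induction ht using Submodule.iSup_induction' with
    | zero => simp
    | add s t _ _ h1 h2 => rw [add_lie]; exact add_mem h1 h2
    | mem α t ht =>
      induction hz using Submodule.iSup_induction' with
      | zero => simp
      | add s t _ _ h1 h2 => rw [lie_add]; exact add_mem h1 h2
      | mem χ z hz => exact Submodule.mem_iSup_of_mem _ (lie_mem_Wt ht hz)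
  · obtain ⟨χ, hχ⟩ := exists_nontrivial_weightSpace_of_isSolvable ℂ H V
    obtain ⟨⟨z, hz⟩, hz0⟩ := exists_ne (0 : weightSpace V χ)
    rw [mem_weightSpace] at hz
    have hz' : z ∈ Wt H V χ := hz
    intro h
    have h2 := Submodule.mem_iSup_of_mem (p := fun χ : Dual ℂ H => Wt H V χ) χ hz'
    rw [h] at h2
    apply hz0
    ext
    simpa using h2

lemma finite_Wt : {χ : Dual ℂ H | Wt H V χ ≠ ⊥}.Finite :=
  WellFoundedGT.finite_ne_bot_of_iSupIndep iSupIndep_Wt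

lemma Sys.exists_weight_ne_zero (S : Sys D) : ∃ χ : Dual ℂ H, χ ≠ 0 ∧ Wt H V χ ≠ ⊥ := by
  by_contra! hcon
  have h1 : Wt H V (0 : Dual ℂ H) = ⊤ := by
    rw [eq_top_iff, ← S.iSup_Wt (H := H)]
    refine iSup_le fun χ => ?_
    by_cases h : χ = 0
    · rw [h]
    · rw [hcon χ h]; exact bot_le
  have hH : ∀ h : H, (h : g) = 0 := by
    intro h
    apply S.faith
    intro z
    have hz : z ∈ Wt H V (0 : Dual ℂ H) := by rw [h1]; trivial
    simpa using hz h
  have hg : ∀ t : g, t = 0 := by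
    intro t
    have : t ∈ Wt H g (0 : Dual ℂ H) := by intro h; rw [hH h]; simp
    exact hH ⟨t, mem_H_of_Wt_zero H this⟩
  obtain ⟨x, y, z, h⟩ := S.nonz
  rw [hg (D x y)] at h
  simp at h

lemma Sys.exists_top (S : Sys D) : ∃ (f : Dual ℂ H →+ ℝ) (Λ : Dual ℂ H), Wt H V Λ ≠ ⊥ ∧ 0 < f Λ ∧
    (∀ χ, Wt H V χ ≠ ⊥ → |f χ| ≤ f Λ) ∧
    (∀ χ χ', Wt H V χ ≠ ⊥ → Wt H V χ' ≠ ⊥ → f χ = f χ' → χ = χ') ∧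
    (∀ α, IsRt H α → f α ≠ 0) := by
  classical
  have hP : {χ : Dual ℂ H | Wt H V χ ≠ ⊥}.Finite := finite_Wt
  have hR : {χ : Dual ℂ H | Wt H g χ ≠ ⊥}.Finite := finite_Wt
  set P := {χ : Dual ℂ H | Wt H V χ ≠ ⊥} with hPdef
  let Q : Set (Dual ℂ H) := (P ∪ {χ : Dual ℂ H | Wt H g χ ≠ ⊥} ∪ (Set.image2 (· - ·) P P)) \ {0}
  have hQ : Q.Finite := ((hP.union hR).union (hP.image2 _ hP)).subset Set.sdiff_subset
  have := hQ.to_subtype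
  obtain ⟨f, hf⟩ := Module.exists_dual_forall_apply_ne_zero (K := ℝ) (fun q : Q => (q : Dual ℂ H))
    (fun q => q.2.2)
  obtain ⟨χ₀, h0, hχ₀⟩ := S.exists_weight_ne_zero (H := H)
  obtain ⟨Λ, hΛ, hmax⟩ := Set.exists_max_image P (fun χ => |f χ|) hP ⟨χ₀, hχ₀⟩
  have key1 : ∀ χ χ', Wt H V χ ≠ ⊥ → Wt H V χ' ≠ ⊥ → f χ = f χ' → χ = χ' := by
    intro χ χ' h h' he
    by_contra hne
    exact hf ⟨χ - χ', Or.inr ⟨χ, h, χ', h', rfl⟩, sub_ne_zero.mpr hne⟩ (by simp [he])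
  have key2 : ∀ α, IsRt H α → f α ≠ 0 := fun α hα =>
    hf ⟨α, Or.inl (Or.inr hα.2), hα.1⟩
  have key3 : f Λ ≠ 0 := by
    intro h
    have h2 := hmax χ₀ hχ₀
    rw [h] at h2
    have h3 : f χ₀ = 0 := by simpa using h2
    exact hf ⟨χ₀, Or.inl (Or.inl hχ₀), h0⟩ h3
  rcases lt_or_gt_of_ne key3 with h | h
  · refine ⟨-f.toAddMonoidHom, Λ, hΛ, by simpa using h, ?_, ?_, ?_⟩
    · intro χ hχ
      have := hmax χ hχ
      rw [abs_of_neg h] at this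
      simpa using this
    · intro χ χ' h h' he
      exact key1 χ χ' h h' (by simpa using he)
    · intro α hα
      simpa using key2 α hα
  · refine ⟨f.toAddMonoidHom, Λ, hΛ, by simpa using h, ?_, ?_, ?_⟩
    · intro χ hχ
      have := hmax χ hχ
      rw [abs_of_pos h] at this
      simpa using this
    · intro χ χ' h h' he
      exact key1 χ χ' h h' (by simpa using he)
    · intro α hα
      simpa using key2 α hα

/-- Vectors generated from `v` by lowering operators. -/
inductive Gen (f : Dual ℂ H →+ ℝ) (v : V) : V → Prop
  | base : Gen f v v
  | step (δ : Dual ℂ H) (s : g) (w : V) (hδ : f δ < 0) (hs : s ∈ Wt H g δ) (hw : Gen f v w) :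
      Gen f v ⁅s, w⁆

lemma Sys.mult_one (S : Sys D) {f : Dual ℂ H →+ ℝ} {Λ : Dual ℂ H}
    (hmax : ∀ χ, Wt H V χ ≠ ⊥ → |f χ| ≤ f Λ) (hroot : ∀ α, IsRt H α → f α ≠ 0)
    {v : V} (hv : v ∈ Wt H V Λ) (hv0 : v ≠ 0) {z : V} (hz : z ∈ Wt H V Λ) : ∃ c : ℂ, z = c • v := by
  set N : Submodule ℂ V := Submodule.span ℂ {w | Gen f v w} with hN
  have lower : ∀ (δ : Dual ℂ H) (s : g), f δ < 0 → s ∈ Wt H g δ → ∀ w ∈ N, ⁅s, w⁆ ∈ N := by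
    intro δ s hδ hs w hw
    induction hw using Submodule.span_induction with
    | mem w hw => exact Submodule.subset_span (Gen.step δ s w hδ hs hw)
    | zero => simp
    | add a c _ _ h1 h2 => rw [lie_add]; exact add_mem h1 h2
    | smul c a _ h => rw [lie_smul]; exact Submodule.smul_mem _ _ h
  have main : ∀ w, Gen f v w → ∀ t : g, ⁅t, w⁆ ∈ N := by
    intro w hw
    induction hw with
    | base =>
      intro t
      have ht : t ∈ ⨆ χ : Dual ℂ H, Wt H g χ := by rw [iSup_Wt_g]; trivial
      induction ht using Submodule.iSup_induction' with
      | zero => simp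
      | add s t _ _ h1 h2 => rw [add_lie]; exact add_mem h1 h2
      | mem α t ht =>
        by_cases h0 : α = 0
        · subst h0
          have := hv ⟨t, mem_H_of_Wt_zero H ht⟩
          simp only at this
          rw [this]
          exact Submodule.smul_mem _ _ (Submodule.subset_span Gen.base)
        by_cases ht0 : t = 0
        · simp [ht0]
        have hα : IsRt H α := ⟨h0, fun h => ht0 (by rw [h] at ht; simpa using ht)⟩
        rcases lt_or_gt_of_ne (hroot α hα) with h | h
        · exact Submodule.subset_span (Gen.step α t v h ht Gen.base)
        · have h1 : ⁅t, v⁆ = 0 := by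
            by_contra hne
            have h2 := hmax (α + Λ) (fun hb => hne (by
              have := lie_mem_Wt ht hv
              rw [hb] at this; simpa using this))
            rw [map_add] at h2
            have := le_abs_self (f α + f Λ)
            linarith
          rw [h1]; exact zero_mem _
    | step δ s w hδ hs hw ih =>
      intro t
      rw [leibniz_lie]
      exact add_mem (ih _) (lower δ s hδ hs _ (ih t))
  have hNtop : N = ⊤ := by
    refine (S.irr N ?_).resolve_left ?_
    · intro t w hw
      induction hw using Submodule.span_induction with
      | mem w hw => exact main w hw t
      | zero => simp
      | add a c _ _ h1 h2 => rw [lie_add]; exact add_mem h1 h2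
      | smul c a _ h => rw [lie_smul]; exact Submodule.smul_mem _ _ h
    · intro h
      have : v ∈ N := Submodule.subset_span Gen.base
      rw [h] at this
      exact hv0 (by simpa using this)
  have hle : N ≤ Submodule.span ℂ {v} ⊔ ⨆ (χ : Dual ℂ H) (_ : χ ≠ Λ), Wt H V χ := by
    rw [hN, Submodule.span_le]
    have h1 : ∀ w, Gen f v w → w = v ∨ ∃ χ : Dual ℂ H, f χ < f Λ ∧ w ∈ Wt H V χ := by
      intro w hw
      induction hw with
      | base => left; rfl
      | step δ s w hδ hs hw ih =>
        right
        rcases ih with rfl | ⟨χ, hχ, hw'⟩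
        · exact ⟨δ + Λ, by rw [map_add]; linarith, lie_mem_Wt hs hv⟩
        · exact ⟨δ + χ, by rw [map_add]; linarith, lie_mem_Wt hs hw'⟩
    intro w hw
    rcases h1 w hw with rfl | ⟨χ, hχ, hw'⟩
    · exact Submodule.mem_sup_left (Submodule.mem_span_singleton_self _)
    · refine Submodule.mem_sup_right ?_
      exact Submodule.mem_iSup_of_mem χ (Submodule.mem_iSup_of_mem (by rintro rfl; exact lt_irrefl _ hχ) hw')
  have hz2 := hle (by rw [hNtop]; trivial : z ∈ N)
  obtain ⟨a, ha, r, hr, har⟩ := Submodule.mem_sup.mp hz2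
  obtain ⟨c, rfl⟩ := Submodule.mem_span_singleton.mp ha
  have hind := iSupIndep_Wt (H := H) (V := V) Λ
  have hr' : r ∈ Wt H V Λ := by
    have : r = z - c • v := by rw [← har]; simp
    rw [this]
    exact sub_mem hz (Submodule.smul_mem _ _ hv)
  have h0 := Submodule.disjoint_def.mp hind r hr' hr
  exact ⟨c, by rw [← har, h0, add_zero]⟩

lemma Sys.exists_pair (S : Sys D) {Λ : Dual ℂ H} (hΛ : Λ ≠ 0) {v : V} (hv : v ∈ Wt H V Λ) (hv0 : v ≠ 0) :
    ∃ (μ : Dual ℂ H) (x y : V), x ∈ Wt H V (-μ) ∧ y ∈ Wt H V μ ∧ ⁅D x y, v⁆ ≠ 0 := by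
  by_contra! hcon
  obtain ⟨h, hh⟩ : ∃ h, Λ h ≠ 0 := by
    by_contra! h; exact hΛ (LinearMap.ext h)
  -- every element of g maps v into the sum of the other weight spaces
  have key : ∀ t : g, ⁅t, v⁆ ∈ ⨆ (χ : Dual ℂ H) (_ : χ ≠ Λ), Wt H V χ := by
    intro t
    have ht : t ∈ Submodule.span ℂ {t | ∃ x y, t = D x y} := by rw [S.span]; trivial
    induction ht using Submodule.span_induction with
    | zero => simp
    | add a c _ _ h1 h2 => rw [add_lie]; exact add_mem h1 h2
    | smul c a _ h => rw [smul_lie]; exact Submodule.smul_mem _ _ h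
    | mem t ht =>
      obtain ⟨x, y, rfl⟩ := ht
      have hx : x ∈ ⨆ χ : Dual ℂ H, Wt H V χ := by rw [S.iSup_Wt]; trivial
      have hy : y ∈ ⨆ χ : Dual ℂ H, Wt H V χ := by rw [S.iSup_Wt]; trivial
      induction hx using Submodule.iSup_induction' with
      | zero => simp
      | add s t _ _ h1 h2 => rw [map_add, LinearMap.add_apply, add_lie]; exact add_mem h1 h2
      | mem a x hx =>
        induction hy using Submodule.iSup_induction' with
        | zero => simp
        | add s t _ _ h1 h2 => rw [map_add, add_lie]; exact add_mem h1 h2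
        | mem c y hy =>
          have h3 := lie_mem_Wt (S.D_mem hx hy) hv
          by_cases hac : a + c = 0
          · have : a = -c := eq_neg_of_add_eq_zero_left hac
            subst this
            rw [hcon c x y hx hy]; exact zero_mem _
          · exact Submodule.mem_iSup_of_mem _ (Submodule.mem_iSup_of_mem (by simpa using hac) h3)
  have hind := iSupIndep_Wt (H := H) (V := V) Λ
  have h1 := key h
  rw [hv h] at h1
  have h0 := Submodule.disjoint_def.mp hind _ (Submodule.smul_mem _ _ hv) h1
  rcases smul_eq_zero.mp h0 with h | h
  · exact hh h
  · exact hv0 h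

end Sys

end LATKeAux

namespace LATKeAux

open Module LieModule LieAlgebra

section Conf

set_option linter.unusedSectionVars false

variable {g : Type} [LieRing g] [LieAlgebra ℂ g]
variable {V : Type} [AddCommGroup V] [Module ℂ V] [LieRingModule g V] [LieModule ℂ g V]
variable [FiniteDimensional ℂ V]

lemma prim_nat {h e f : g} (t : IsSl2Triple h e f) {z : V} {c : ℂ} (hz : z ≠ 0)
    (hh : ⁅h, z⁆ = c • z) (he : ⁅e, z⁆ = 0) : ∃ n : ℕ, c = n := by
  have P : t.HasPrimitiveVectorWith z c := ⟨hz, hh, he⟩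
  exact P.exists_nat

lemma prim_nat_neg {h e f : g} (t : IsSl2Triple h e f) {z : V} {c : ℂ} (hz : z ≠ 0)
    (hh : ⁅h, z⁆ = c • z) (hf : ⁅f, z⁆ = 0) : ∃ n : ℕ, c = -n := by
  obtain ⟨n, hn⟩ := prim_nat t.symm hz (c := -c) (by rw [neg_lie, hh, neg_smul]) hf
  exact ⟨n, by rw [← hn, neg_neg]⟩

variable {H : LieSubalgebra ℂ g}

lemma line_transport {c : H} {e f : g} (t : IsSl2Triple (c : g) e f) {χ α : Dual ℂ H} {z₀ w₀ : V}
    (hz₀ : z₀ ∈ Wt H V χ) (hne : z₀ ≠ 0) (hc : χ c = -1) (he : e ∈ Wt H g α)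
    (hline : ∀ w ∈ Wt H V (α + χ), ∃ s : ℂ, w = s • w₀) :
    ∀ z ∈ Wt H V χ, ∃ s : ℂ, z = s • z₀ := by
  have key : ∀ z ∈ Wt H V χ, ⁅e, z⁆ = 0 → z = 0 := by
    intro z hz h0
    by_contra hz0
    obtain ⟨n, hn⟩ := prim_nat t hz0 (hz c) h0
    rw [hc] at hn
    have h1 : ((n + 1 : ℕ) : ℂ) = 0 := by push_cast; rw [← hn]; ring
    norm_cast at h1
  intro z hz
  obtain ⟨a, ha⟩ := hline _ (lie_mem_Wt he hz₀)
  obtain ⟨d, hd⟩ := hline _ (lie_mem_Wt he hz)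
  have ha0 : a ≠ 0 := by
    rintro rfl
    exact hne (key _ hz₀ (by rw [ha, zero_smul]))
  refine ⟨d / a, ?_⟩
  have := key (z - (d / a) • z₀) (sub_mem hz (Submodule.smul_mem _ _ hz₀)) (by
    rw [lie_sub, lie_smul, ha, hd, smul_smul, div_mul_cancel₀ _ ha0, sub_self])
  exact sub_eq_zero.mp this

/-- The configuration found inside a simple LATKe. -/
structure Conf (D : V →ₗ[ℂ] V →ₗ[ℂ] g) (H : LieSubalgebra ℂ g) where
  f : Dual ℂ H →+ ℝ
  lam : Dual ℂ H
  mu : Dual ℂ H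
  cb : H
  cc : H
  eb : g
  fb : g
  ec : g
  fc : g
  v : V
  x : V
  y : V
  u : V
  hv : v ∈ Wt H V lam
  hx : x ∈ Wt H V (-mu)
  hy : y ∈ Wt H V mu
  hu : u ∈ Wt H V (-lam)
  v0 : v ≠ 0
  x0 : x ≠ 0
  y0 : y ≠ 0
  u0 : u ≠ 0
  tb : IsSl2Triple (cb : g) eb fb
  tc : IsSl2Triple (cc : g) ec fc
  heb : eb ∈ Wt H g (lam + mu)
  hfb : fb ∈ Wt H g (-(lam + mu))
  hec : ec ∈ Wt H g (lam + -mu)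
  hfc : fc ∈ Wt H g (-(lam + -mu))
  lam_cb : lam cb = 1
  mu_cb : mu cb = 1
  lam_cc : lam cc = 1
  mu_cc : mu cc = -1
  reb : ∀ t ∈ Wt H g (lam + mu), ∃ s : ℂ, t = s • eb
  rfb : ∀ t ∈ Wt H g (-(lam + mu)), ∃ s : ℂ, t = s • fb
  rec' : ∀ t ∈ Wt H g (lam + -mu), ∃ s : ℂ, t = s • ec
  rfc : ∀ t ∈ Wt H g (-(lam + -mu)), ∃ s : ℂ, t = s • fc
  lv : ∀ z ∈ Wt H V lam, ∃ s : ℂ, z = s • v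
  lx : ∀ z ∈ Wt H V (-mu), ∃ s : ℂ, z = s • x
  ly : ∀ z ∈ Wt H V mu, ∃ s : ℂ, z = s • y
  lu : ∀ z ∈ Wt H V (-lam), ∃ s : ℂ, z = s • u
  nz : ⁅D x y, v⁆ ≠ 0
  ebv : ⁅eb, v⁆ = 0
  flam : 0 < f lam
  fle : ∀ χ, Wt H V χ ≠ ⊥ → |f χ| ≤ f lam
  finj : ∀ χ χ', Wt H V χ ≠ ⊥ → Wt H V χ' ≠ ⊥ → f χ = f χ' → χ = χ'

variable [FiniteDimensional ℂ g] [IsKilling ℂ g] [H.IsCartanSubalgebra]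
variable {D : V →ₗ[ℂ] V →ₗ[ℂ] g}

lemma Sys.exists_conf (S : Sys D) : Nonempty (Conf D H) := by
  obtain ⟨f, Λ, hΛ, hpos, hmax, hinj, hroot⟩ := S.exists_top (H := H)
  obtain ⟨v, hv, v0⟩ := Submodule.exists_mem_ne_zero_of_ne_bot hΛ
  have hΛ0 : Λ ≠ 0 := by rintro rfl; simp at hpos
  have lv : ∀ z ∈ Wt H V Λ, ∃ s : ℂ, z = s • v := fun z hz => S.mult_one hmax hroot hv v0 hz
  obtain ⟨μ, x, y, hx, hy, nz⟩ := S.exists_pair hΛ0 hv v0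
  obtain ⟨co, hco, hpair⟩ := exists_coroots H
  have nz1 : ⁅D v x, y⁆ ≠ 0 := by rwa [S.cyc v x y]
  have nz2 : ⁅D v y, x⁆ ≠ 0 := by rw [S.alt]; simpa using nz1
  have x0 : x ≠ 0 := by rintro rfl; simp at nz2
  have y0 : y ≠ 0 := by rintro rfl; simp at nz1
  have hDy := S.D_mem hv hy
  have hDx := S.D_mem hv hx
  have rb : IsRt H (Λ + μ) := by
    constructor
    · intro h
      have : -μ = Λ := (eq_neg_of_add_eq_zero_left h).symm
      rw [this] at hx
      obtain ⟨c, rfl⟩ := lv x hx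
      rw [lie_smul, S.self_left, smul_zero] at nz2
      exact nz2 rfl
    · intro h
      rw [h] at hDy
      rw [(Submodule.mem_bot ℂ).mp hDy, zero_lie] at nz2
      exact nz2 rfl
  have rc : IsRt H (Λ + -μ) := by
    constructor
    · intro h
      have : μ = Λ := by rw [← sub_eq_add_neg, sub_eq_zero] at h; exact h.symm
      rw [this] at hy
      obtain ⟨c, rfl⟩ := lv y hy
      rw [lie_smul, S.self_left, smul_zero] at nz1
      exact nz1 rfl
    · intro h
      rw [h] at hDx
      rw [(Submodule.mem_bot ℂ).mp hDx, zero_lie] at nz1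
      exact nz1 rfl
  obtain ⟨b2, eb, fb, tb, heb, hfb, reb, rfb⟩ := hco _ rb
  obtain ⟨c2, ec, fc, tc, hec, hfc, rec', rfc⟩ := hco _ rc
  have hp := hpair _ _ rb rc
  set cb := co (Λ + μ)
  set cc := co (Λ + -μ)
  obtain ⟨s, hs⟩ := reb _ hDy
  obtain ⟨s', hs'⟩ := rec' _ hDx
  have s0 : s ≠ 0 := by rintro rfl; rw [hs] at nz2; simp at nz2
  have s0' : s' ≠ 0 := by rintro rfl; rw [hs'] at nz1; simp at nz1
  have ebv : ⁅eb, v⁆ = 0 := by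
    have := S.self_left v y
    rw [hs, smul_lie] at this
    exact (smul_eq_zero.mp this).resolve_left s0
  have eby : ⁅eb, y⁆ = 0 := by
    have := S.self_right v y
    rw [hs, smul_lie] at this
    exact (smul_eq_zero.mp this).resolve_left s0
  have ecv : ⁅ec, v⁆ = 0 := by
    have := S.self_left v x
    rw [hs', smul_lie] at this
    exact (smul_eq_zero.mp this).resolve_left s0'
  have ecx : ⁅ec, x⁆ = 0 := by
    have := S.self_right v x
    rw [hs', smul_lie] at this
    exact (smul_eq_zero.mp this).resolve_left s0'
  obtain ⟨p, hp1⟩ := prim_nat tb v0 (hv cb) ebv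
  obtain ⟨q, hq1⟩ := prim_nat tb y0 (hy cb) eby
  obtain ⟨p', hp2⟩ := prim_nat tc v0 (hv cc) ecv
  obtain ⟨q', hq2⟩ := prim_nat tc x0 (hx cc) ecx
  simp only [LinearMap.add_apply, LinearMap.neg_apply] at b2 c2 hp hq2
  have hq2' : μ cc = -q' := by rw [← hq2, neg_neg]
  rw [hp1, hq1] at b2 hp
  rw [hp2, hq2'] at c2 hp
  have hpq : p + q = 2 := by exact_mod_cast b2
  have hpq' : p' + q' = 2 := by rw [neg_neg] at c2; exact_mod_cast c2
  have hp' := hp (by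
      have h1 : p ≤ 2 := by omega
      obtain rfl : q = 2 - p := by omega
      interval_cases p <;> norm_num) (by
      have h1 : p' ≤ 2 := by omega
      obtain rfl : q' = 2 - p' := by omega
      interval_cases p' <;> norm_num)
  have horth : p = 1 ∧ q = 1 ∧ p' = 1 ∧ q' = 1 := by
    rcases hp' with ⟨h1, h2⟩ | h | h
    · have h3 : (p : ℂ) = q := by linear_combination h1
      have h4 : (p' : ℂ) = q' := by linear_combination h2
      norm_cast at h3 h4
      omega
    · exfalso
      rw [h] at hDx
      obtain ⟨r, hr⟩ := reb _ hDx
      have : ⁅D v x, y⁆ = 0 := by rw [hr, smul_lie, eby, smul_zero]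
      exact nz1 this
    · exfalso
      apply hΛ0
      have h2 : (2 : ℂ) • Λ = 0 := by
        ext t
        have := LinearMap.congr_fun h t
        simp only [LinearMap.add_apply, LinearMap.neg_apply] at this
        simp only [LinearMap.smul_apply, smul_eq_mul, LinearMap.zero_apply]
        linear_combination this
      simpa using h2
  obtain ⟨rfl, rfl, rfl, rfl⟩ := horth
  norm_num at hp1 hq1 hp2 hq2'
  have hu : ⁅fc, x⁆ ∈ Wt H V (-Λ) := by
    have := lie_mem_Wt hfc hx
    convert this using 1
    abel_nf
  have u0 : ⁅fc, x⁆ ≠ 0 := by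
    intro h
    obtain ⟨n, hn⟩ := prim_nat_neg tc x0 (hx cc) h
    simp only [LinearMap.neg_apply, hq2'] at hn
    have h1 : ((n + 1 : ℕ) : ℂ) = 0 := by push_cast; linear_combination hn
    norm_cast at h1
  have ly : ∀ z ∈ Wt H V μ, ∃ s : ℂ, z = s • y :=
    line_transport tc hy y0 hq2' hec (w₀ := v) (by simpa using lv)
  have lx : ∀ z ∈ Wt H V (-μ), ∃ s : ℂ, z = s • x :=
    line_transport tb hx x0 (by simp [hq1]) heb (w₀ := v) (by simpa using lv)
  have lu : ∀ z ∈ Wt H V (-Λ), ∃ s : ℂ, z = s • ⁅fc, x⁆ :=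
    line_transport tb hu u0 (by simp [hp1]) heb (w₀ := y) (by simpa using ly)
  exact ⟨{ f := f, lam := Λ, mu := μ, cb := cb, cc := cc, eb := eb, fb := fb, ec := ec, fc := fc,
           v := v, x := x, y := y, u := ⁅fc, x⁆, hv := hv, hx := hx, hy := hy, hu := hu, v0 := v0,
           x0 := x0, y0 := y0, u0 := u0, tb := tb, tc := tc, heb := heb, hfb := hfb, hec := hec,
           hfc := hfc, lam_cb := hp1, mu_cb := hq1, lam_cc := hp2, mu_cc := hq2', reb := reb,
           rfb := rfb, rec' := rec', rfc := rfc, lv := lv, lx := lx, ly := ly, lu := lu, nz := nz,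
           ebv := ebv, flam := hpos, fle := hmax, finj := hinj }⟩

end Conf

end LATKeAux

namespace LATKeAux

open Module LieModule LieAlgebra

section Cst

set_option linter.unusedSectionVars false

variable {g : Type} [LieRing g] [LieAlgebra ℂ g]
variable {V : Type} [AddCommGroup V] [Module ℂ V] [LieRingModule g V] [LieModule ℂ g V]
variable [FiniteDimensional ℂ V]
variable {H : LieSubalgebra ℂ g}
variable {D : V →ₗ[ℂ] V →ₗ[ℂ] g}

/-- Structure constants of a configuration. -/
structure Cst (K : Conf D H) where
  m : ℂ
  n : ℂ
  h : H
  h' : H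
  m0 : m ≠ 0
  n0 : n ≠ 0
  hh : (h : g) = D K.v K.u
  hh' : (h' : g) = D K.x K.y
  eh : h = (m / 2) • (K.cb - K.cc)
  eh' : h' = (n / 2) • (K.cb + K.cc)
  vuy : ⁅D K.v K.u, K.y⁆ = m • K.y
  vux : ⁅D K.v K.u, K.x⁆ = -m • K.x
  xyv : ⁅D K.x K.y, K.v⁆ = n • K.v
  xyu : ⁅D K.x K.y, K.u⁆ = -n • K.u
  ebec : ⁅K.eb, K.ec⁆ = 0
  ebfc : ⁅K.eb, K.fc⁆ = 0
  fbu : ⁅K.fb, K.u⁆ = 0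

variable [FiniteDimensional ℂ g] [IsKilling ℂ g] [H.IsCartanSubalgebra]

lemma Sys.exists_cst (S : Sys D) (K : Conf D H) : Nonempty (Cst K) := by
  obtain ⟨h, hh⟩ : ∃ h : H, (h : g) = D K.v K.u :=
    ⟨⟨_, mem_H_of_Wt_zero H (by simpa using S.D_mem K.hv K.hu)⟩, rfl⟩
  obtain ⟨h', hh'⟩ : ∃ h' : H, (h' : g) = D K.x K.y :=
    ⟨⟨_, mem_H_of_Wt_zero H (by simpa using S.D_mem K.hx K.hy)⟩, rfl⟩
  obtain ⟨m, hm⟩ : ∃ m, m = K.mu h := ⟨_, rfl⟩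
  obtain ⟨n, hn⟩ : ∃ n, n = K.lam h' := ⟨_, rfl⟩
  have lamh : K.lam h = 0 := by
    have := K.hv h
    rw [hh, S.self_left] at this
    exact (smul_eq_zero.mp this.symm).resolve_right K.v0
  have vuy : ⁅D K.v K.u, K.y⁆ = m • K.y := by rw [← hh, hm]; exact K.hy h
  have vux : ⁅D K.v K.u, K.x⁆ = -m • K.x := by rw [← hh, hm]; simpa using K.hx h
  have xyv : ⁅D K.x K.y, K.v⁆ = n • K.v := by rw [← hh', hn]; exact K.hv h'
  have xyu : ⁅D K.x K.y, K.u⁆ = -n • K.u := by rw [← hh', hn]; simpa using K.hu h'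
  have n0 : n ≠ 0 := by
    rintro h0
    exact K.nz (by rw [xyv, h0, zero_smul])
  have vyx : ⁅D K.v K.y, K.x⁆ = -n • K.v := by
    rw [S.alt, S.cyc, xyv, neg_smul]
  have vxy : ⁅D K.v K.x, K.y⁆ = n • K.v := by rw [S.cyc, xyv]
  have vyu : ⁅D K.v K.y, K.u⁆ = -m • K.y := by rw [S.alt, vuy, neg_smul]
  have vxu : ⁅D K.v K.x, K.u⁆ = m • K.x := by rw [S.alt, vux]; simp
  have uxy : ⁅D K.u K.x, K.y⁆ = -n • K.u := by rw [S.cyc, xyu]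
  have uyx : ⁅D K.u K.y, K.x⁆ = n • K.u := by rw [S.alt, uxy]; simp
  obtain ⟨s, hs⟩ := K.reb _ (S.D_mem K.hv K.hy)
  obtain ⟨s', hs'⟩ := K.rec' _ (S.D_mem K.hv K.hx)
  obtain ⟨r, hr⟩ := K.rfb (D K.u K.x) (by
    have := S.D_mem K.hu K.hx
    rwa [← neg_add] at this)
  obtain ⟨r', hr'⟩ := K.rfc (D K.u K.y) (by
    have := S.D_mem K.hu K.hy
    rwa [show -K.lam + K.mu = -(K.lam + -K.mu) by abel] at this)
  have s0 : s ≠ 0 := by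
    rintro rfl
    rw [hs] at vyx
    simp [n0, K.v0] at vyx
  have s0' : s' ≠ 0 := by
    rintro rfl
    rw [hs'] at vxy
    simp [n0, K.v0, eq_comm] at vxy
  have r0 : r ≠ 0 := by
    rintro rfl
    rw [hr] at uxy
    simp [n0, K.u0] at uxy
  have r0' : r' ≠ 0 := by
    rintro rfl
    rw [hr'] at uyx
    simp [n0, K.u0, eq_comm] at uyx
  have m0 : m ≠ 0 := by
    intro h0
    obtain ⟨w, hw⟩ := K.ly ⁅K.eb, K.u⁆ (by
      have := lie_mem_Wt K.heb K.hu
      rwa [show K.lam + K.mu + -K.lam = K.mu by abel] at this)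
    have w0 : w ≠ 0 := by
      rintro rfl
      rw [zero_smul] at hw
      obtain ⟨k, hk⟩ := prim_nat K.tb K.u0 (K.hu K.cb) hw
      simp only [LinearMap.neg_apply, K.lam_cb] at hk
      have h1 : ((k + 1 : ℕ) : ℂ) = 0 := by push_cast; rw [← hk]; ring
      norm_cast at h1
    have h1 := S.equiv K.eb K.v K.u
    rw [K.ebv, hw, map_zero, LinearMap.zero_apply, zero_add, map_smul, ← hh, ← lie_skew,
      K.heb h, LinearMap.add_apply, lamh, ← hm, h0, add_zero, zero_smul, neg_zero] at h1
    have h2 := (smul_eq_zero.mp h1.symm).resolve_left w0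
    rw [h2, zero_lie] at vyx
    simp [n0, K.v0] at vyx
  have R1 : (m • h' + n • h : H) = (m * n) • K.cb := by
    have h1 := S.equiv (D K.v K.y) K.u K.x
    rw [vyu, vyx, hs, hr, lie_smul, smul_lie, K.tb.lie_e_f] at h1
    simp only [map_smul, LinearMap.smul_apply] at h1
    rw [S.skew K.y K.x, S.skew K.u K.v, ← hh, ← hh'] at h1
    have h2 : (m • h' + n • h : H) = (r * s) • K.cb := by
      ext
      push_cast
      rw [mul_smul, h1]
      simp
    have h3 := congrArg K.lam h2
    simp only [map_add, map_smul, lamh, ← hn, K.lam_cb, smul_eq_mul] at h3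
    rw [h2]
    congr 1
    linear_combination -h3
  have R2 : (m • h' - n • h : H) = (m * n) • K.cc := by
    have h1 := S.equiv (D K.v K.x) K.u K.y
    rw [vxu, vxy, hs', hr', lie_smul, smul_lie, K.tc.lie_e_f] at h1
    simp only [map_smul, LinearMap.smul_apply] at h1
    rw [S.skew K.u K.v, ← hh, ← hh'] at h1
    have h2 : (m • h' - n • h : H) = (r' * s') • K.cc := by
      ext
      push_cast
      rw [mul_smul, h1]
      simp [sub_eq_add_neg]
    have h3 := congrArg K.lam h2
    simp only [map_sub, map_smul, lamh, ← hn, K.lam_cc, smul_eq_mul] at h3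
    rw [h2]
    congr 1
    linear_combination -h3
  refine ⟨{ m := m, n := n, h := h, h' := h', m0 := m0, n0 := n0, hh := hh, hh' := hh',
            eh := ?_, eh' := ?_, vuy := vuy, vux := vux, xyv := xyv, xyu := xyu, ebec := ?_, ebfc := ?_, fbu := ?_ }⟩
  · have h1 : (m * n) • (K.cb - K.cc) = (2 * n) • h := by
      rw [smul_sub, ← R1, ← R2, two_mul, add_smul]; abel
    have h2 : h = (2 * n)⁻¹ • ((m * n) • (K.cb - K.cc)) := by
      rw [h1, smul_smul, inv_mul_cancel₀ (by simp [n0]), one_smul]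
    rw [h2, smul_smul]
    congr 1
    field_simp
  · have h1 : (m * n) • (K.cb + K.cc) = (2 * m) • h' := by
      rw [smul_add, ← R1, ← R2, two_mul, add_smul]; abel
    have h2 : h' = (2 * m)⁻¹ • ((m * n) • (K.cb + K.cc)) := by
      rw [h1, smul_smul, inv_mul_cancel₀ (by simp [m0]), one_smul]
    rw [h2, smul_smul]
    congr 1
    field_simp
  · have h1 := S.equiv (D K.v K.y) K.v K.x
    rw [vyx, S.self_left] at h1
    simp only [map_zero, LinearMap.zero_apply, map_smul, S.self, smul_zero, add_zero, hs, hs',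
      smul_lie, lie_smul] at h1
    simpa [s0, s0'] using h1
  · have h1 := S.equiv (D K.v K.y) K.u K.y
    rw [vyu, S.self_right] at h1
    simp only [map_zero, map_smul, S.self, smul_zero, LinearMap.smul_apply, add_zero, hs, hr',
      smul_lie, lie_smul] at h1
    simpa [s0, r0'] using h1
  · have h1 := S.self_left K.u K.x
    rw [hr, smul_lie] at h1
    exact (smul_eq_zero.mp h1).resolve_left r0

/-- The opposite configuration. -/
noncomputable def Conf.dual (K : Conf D H) (hfbu : ⁅K.fb, K.u⁆ = 0) (hnz : ⁅D K.y K.x, K.u⁆ ≠ 0) :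
    Conf D H where
  f := -K.f
  lam := -K.lam
  mu := -K.mu
  cb := -K.cb
  cc := -K.cc
  eb := K.fb
  fb := K.eb
  ec := K.fc
  fc := K.ec
  v := K.u
  x := K.y
  y := K.x
  u := K.v
  hv := K.hu
  hx := by simpa using K.hy
  hy := K.hx
  hu := by simpa using K.hv
  v0 := K.u0
  x0 := K.y0
  y0 := K.x0
  u0 := K.v0
  tb := by simpa using K.tb.symm
  tc := by simpa using K.tc.symm
  heb := by rw [← neg_add]; exact K.hfb
  hfb := by rw [← neg_add, neg_neg]; exact K.heb
  hec := by rw [← neg_add]; exact K.hfc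
  hfc := by rw [← neg_add, neg_neg]; exact K.hec
  lam_cb := by simp [K.lam_cb]
  mu_cb := by simp [K.mu_cb]
  lam_cc := by simp [K.lam_cc]
  mu_cc := by simp [K.mu_cc]
  reb := by rw [← neg_add]; exact K.rfb
  rfb := by rw [← neg_add, neg_neg]; exact K.reb
  rec' := by rw [← neg_add]; exact K.rfc
  rfc := by rw [← neg_add, neg_neg]; exact K.rec'
  lv := K.lu
  lx := by simpa using K.ly
  ly := K.lx
  lu := by simpa using K.lv
  nz := hnz
  ebv := hfbu
  flam := by simpa using K.flam
  fle := by
    intro χ h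
    simpa using K.fle χ h
  finj := by
    intro χ χ' h1 h2 h3
    exact K.finj χ χ' h1 h2 (by simpa using h3)

end Cst

end LATKeAux

namespace LATKeAux

open Module LieModule LieAlgebra

section Classify

set_option linter.unusedSectionVars false

variable {g : Type} [LieRing g] [LieAlgebra ℂ g]
variable {V : Type} [AddCommGroup V] [Module ℂ V] [LieRingModule g V] [LieModule ℂ g V]
variable [FiniteDimensional ℂ V]
variable {H : LieSubalgebra ℂ g}
variable {D : V →ₗ[ℂ] V →ₗ[ℂ] g}

lemma pow_mem_Wt {α χ : Dual ℂ H} {t : g} {z : V} (ht : t ∈ Wt H g α) (hz : z ∈ Wt H V χ) (k : ℕ) :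
    (toEnd ℂ g V t ^ k) z ∈ Wt H V (k • α + χ) := by
  induction k with
  | zero => simpa using hz
  | succ k ih =>
    rw [pow_succ', Module.End.mul_apply, toEnd_apply_apply]
    have := lie_mem_Wt ht ih
    rwa [show α + (k • α + χ) = (k + 1) • α + χ by rw [succ_nsmul]; abel] at this

lemma lie_pow_eq_zero {e f : g} {z : V} (hef : ⁅e, f⁆ = 0) (hz : ⁅e, z⁆ = 0) (k : ℕ) :
    ⁅e, (toEnd ℂ g V f ^ k) z⁆ = 0 := by
  induction k with
  | zero => simpa using hz
  | succ k ih =>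
    rw [pow_succ', Module.End.mul_apply, toEnd_apply_apply, leibniz_lie, hef, ih]
    simp

lemma ne_bot_of_mem {χ : Dual ℂ H} {z : V} (hz : z ∈ Wt H V χ) (h0 : z ≠ 0) : Wt H V χ ≠ ⊥ := by
  intro h
  rw [h] at hz
  exact h0 (by simpa using hz)

variable [FiniteDimensional ℂ g] [IsKilling ℂ g] [H.IsCartanSubalgebra]

lemma exists_raise {α χ : Dual ℂ H} {t : g} {z : V} (hα : α ≠ 0) (ht : t ∈ Wt H g α)
    (hz : z ∈ Wt H V χ) (h0 : z ≠ 0) :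
    ∃ i : ℕ, (toEnd ℂ g V t ^ i) z ≠ 0 ∧ ⁅t, (toEnd ℂ g V t ^ i) z⁆ = 0 := by
  classical
  by_cases hk : ∃ k, (toEnd ℂ g V t ^ k) z = 0
  · have h1 := Nat.find_spec hk
    have h2 : Nat.find hk ≠ 0 := by
      intro h
      rw [h] at h1
      exact h0 (by simpa using h1)
    obtain ⟨i, hi⟩ := Nat.exists_eq_succ_of_ne_zero h2
    refine ⟨i, Nat.find_min hk (by omega), ?_⟩
    rw [hi, Nat.succ_eq_add_one, pow_succ', Module.End.mul_apply, toEnd_apply_apply] at h1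
    exact h1
  · exfalso
    push Not at hk
    have hfin : {χ : Dual ℂ H | Wt H V χ ≠ ⊥}.Finite := finite_Wt
    refine Set.infinite_of_injective_forall_mem (f := fun k : ℕ => k • α + χ) ?_ ?_ hfin
    · intro a b hab
      simp only [add_left_inj] at hab
      have h3 : ((a : ℂ) - b) • α = 0 := by
        rw [sub_smul, Nat.cast_smul_eq_nsmul, Nat.cast_smul_eq_nsmul, hab, sub_self]
      have h4 := (smul_eq_zero.mp h3).resolve_right hα
      exact_mod_cast sub_eq_zero.mp h4
    · intro k
      exact ne_bot_of_mem (pow_mem_Wt ht hz k) (hk k)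

lemma Sys.highest (S : Sys D) (K : Conf D H) {χ : Dual ℂ H} {z : V} (hz : z ∈ Wt H V χ)
    (h0 : z ≠ 0) (hb : ⁅K.eb, z⁆ = 0) (hc : ⁅K.ec, z⁆ = 0) :
    (χ K.cb = 0 ∧ χ K.cc = 0) ∨ χ = K.lam := by
  obtain ⟨c⟩ := S.exists_cst K
  obtain ⟨a, ha⟩ := prim_nat K.tb h0 (hz K.cb) hb
  obtain ⟨b, hb'⟩ := prim_nat K.tc h0 (hz K.cc) hc
  have hvuz : ⁅D K.v K.u, z⁆ = χ c.h • z := by rw [← c.hh]; exact hz c.h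
  have hxyz : ⁅D K.x K.y, z⁆ = χ c.h' • z := by rw [← c.hh']; exact hz c.h'
  have hzvx : ⁅D z K.v, K.x⁆ = 0 := by
    obtain ⟨s, hs⟩ := K.rec' _ (S.D_mem K.hv K.hx)
    rw [S.cyc, hs, smul_lie, hc, smul_zero]
  have hzvy : ⁅D z K.v, K.y⁆ = 0 := by
    obtain ⟨s, hs⟩ := K.reb _ (S.D_mem K.hv K.hy)
    rw [S.cyc, hs, smul_lie, hb, smul_zero]
  have hzvu : ⁅D z K.v, K.u⁆ = χ c.h • z := by rw [S.cyc, hvuz]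
  have key := leibniz_lie (D z K.v) (D K.u K.x) K.y
  rw [S.equiv, hzvx, hzvy, hzvu, S.cyc K.u K.x K.y, c.xyu, lie_smul, hzvu] at key
  simp only [map_smul, map_zero, add_zero, lie_zero, LinearMap.smul_apply, smul_lie] at key
  rw [S.cyc z K.x K.y, hxyz, smul_smul, smul_smul, ← sub_eq_zero, ← sub_smul] at key
  have k2 := (smul_eq_zero.mp key).resolve_right h0
  rw [c.eh, c.eh'] at k2
  simp only [map_smul, map_sub, map_add, smul_eq_mul, ha, hb'] at k2
  have k3 : c.m * c.n * (((a : ℂ) - b) * (a + b + 2)) = 0 := by linear_combination -4 * k2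
  have hab : a = b := by
    simp only [mul_eq_zero, c.m0, c.n0, false_or] at k3
    rcases k3 with k | k
    · exact_mod_cast sub_eq_zero.mp k
    · exfalso
      norm_cast at k
  subst hab
  rcases Nat.eq_zero_or_pos a with rfl | hpos
  · left; simp [ha, hb']
  right
  have P1 : K.tc.HasPrimitiveVectorWith z (a : ℂ) := ⟨h0, by rw [hz K.cc, hb'], hc⟩
  have w0 := P1.pow_toEnd_f_ne_zero_of_eq_nat rfl le_rfl
  have hw := pow_mem_Wt K.hfc hz a
  have hbw := lie_pow_eq_zero c.ebfc hb a
  have P2 : K.tb.HasPrimitiveVectorWith ((toEnd ℂ g V K.fc ^ a) z) (a : ℂ) := by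
    refine ⟨w0, ?_, hbw⟩
    rw [hw K.cb]
    simp [ha, K.lam_cb, K.mu_cb]
  have w0' := P2.pow_toEnd_f_ne_zero_of_eq_nat rfl le_rfl
  have hw' := pow_mem_Wt K.hfb hw a
  have n1 := ne_bot_of_mem hw' w0'
  have n2 := ne_bot_of_mem hz h0
  have f1 := (abs_le.mp (K.fle _ n1)).1
  have f2 := (abs_le.mp (K.fle _ n2)).2
  simp only [map_add, map_nsmul, map_neg, nsmul_eq_mul] at f1
  have hp := K.flam
  have ha1 : (1 : ℝ) ≤ a := by exact_mod_cast hpos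
  apply K.finj _ _ n2 (ne_bot_of_mem K.hv K.v0)
  nlinarith [mul_le_mul_of_nonneg_right ha1 hp.le]

lemma Sys.upper (S : Sys D) (K : Conf D H) {χ : Dual ℂ H} {z : V} (hz : z ∈ Wt H V χ)
    (h0 : z ≠ 0) :
    (∃ i j : ℕ, χ K.cb = -2 * i ∧ χ K.cc = -2 * j) ∨
    (∃ i j : ℕ, χ = K.lam - i • (K.lam + K.mu) - j • (K.lam - K.mu)) := by
  obtain ⟨c⟩ := S.exists_cst K
  have hb0 : K.lam + K.mu ≠ 0 := by
    intro h
    have := LinearMap.congr_fun h K.cb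
    simp only [LinearMap.add_apply, K.lam_cb, K.mu_cb, LinearMap.zero_apply] at this
    norm_num at this
  have hc0 : K.lam + -K.mu ≠ 0 := by
    intro h
    have := LinearMap.congr_fun h K.cc
    simp only [LinearMap.add_apply, LinearMap.neg_apply, K.lam_cc, K.mu_cc, LinearMap.zero_apply] at this
    norm_num at this
  obtain ⟨i, hi, hi'⟩ := exists_raise hb0 K.heb hz h0
  have hz1 := pow_mem_Wt K.heb hz i
  obtain ⟨j, hj, hj'⟩ := exists_raise hc0 K.hec hz1 hi
  have hz2 := pow_mem_Wt K.hec hz1 j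
  rcases S.highest K hz2 hj (lie_pow_eq_zero c.ebec hi' j) hj' with ⟨h1, h2⟩ | h
  · left
    refine ⟨i, j, ?_, ?_⟩
    · simp only [LinearMap.add_apply, LinearMap.smul_apply, LinearMap.neg_apply, nsmul_eq_mul,
        K.lam_cb, K.mu_cb] at h1
      linear_combination h1
    · simp only [LinearMap.add_apply, LinearMap.smul_apply, LinearMap.neg_apply, nsmul_eq_mul,
        K.lam_cc, K.mu_cc] at h2
      linear_combination h2
  · right
    refine ⟨i, j, ?_⟩
    have : χ = (j • (K.lam + -K.mu) + (i • (K.lam + K.mu) + χ)) - i • (K.lam + K.mu) - j • (K.lam - K.mu) := by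
      rw [sub_eq_add_neg K.lam]; abel
    rw [this, h]

lemma Sys.classify (S : Sys D) (K : Conf D H) {χ : Dual ℂ H} {z : V} (hz : z ∈ Wt H V χ)
    (h0 : z ≠ 0) :
    (χ K.cb = 0 ∧ χ K.cc = 0) ∨ χ = K.lam ∨ χ = K.mu ∨ χ = -K.mu ∨ χ = -K.lam := by
  obtain ⟨c⟩ := S.exists_cst K
  have hnz : ⁅D K.y K.x, K.u⁆ ≠ 0 := by
    rw [S.skew, neg_lie, c.xyu]
    simp [c.n0, K.u0]
  have hu := S.upper K hz h0
  have hl := S.upper (K.dual c.fbu hnz) hz h0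
  simp only [Conf.dual, map_neg] at hl
  rcases hu with ⟨i, j, h1, h2⟩ | ⟨i, j, h⟩
  · left
    rcases hl with ⟨k, l, h3, h4⟩ | ⟨k, l, h⟩
    · rw [h1] at h3
      rw [h2] at h4
      have e1 : ((i + k : ℕ) : ℂ) = 0 := by push_cast; linear_combination h3 / 2
      have e2 : ((j + l : ℕ) : ℂ) = 0 := by push_cast; linear_combination h4 / 2
      norm_cast at e1 e2
      obtain rfl : i = 0 := by omega
      obtain rfl : j = 0 := by omega
      simp [h1, h2]
    · exfalso
      have := LinearMap.congr_fun h K.cb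
      rw [h1] at this
      simp only [LinearMap.add_apply, LinearMap.smul_apply, LinearMap.neg_apply, nsmul_eq_mul,
        LinearMap.sub_apply, K.lam_cb, K.mu_cb] at this
      have e : ((2 * i + 2 * k : ℕ) : ℂ) = ((1 : ℕ) : ℂ) := by push_cast; linear_combination -this
      norm_cast at e
      omega
  · right
    have hb := LinearMap.congr_fun h K.cb
    have hc := LinearMap.congr_fun h K.cc
    simp only [LinearMap.add_apply, LinearMap.smul_apply, LinearMap.neg_apply, nsmul_eq_mul,
        LinearMap.sub_apply, K.lam_cb, K.mu_cb, K.lam_cc, K.mu_cc] at hb hc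
    rcases hl with ⟨k, l, h3, h4⟩ | ⟨k, l, h'⟩
    · exfalso
      rw [hb] at h3
      have e : ((2 * i + 2 * k : ℕ) : ℂ) = ((1 : ℕ) : ℂ) := by push_cast; linear_combination h3
      norm_cast at e
      omega
    · have hb' := LinearMap.congr_fun h' K.cb
      have hc' := LinearMap.congr_fun h' K.cc
      simp only [LinearMap.add_apply, LinearMap.smul_apply, LinearMap.neg_apply, nsmul_eq_mul,
        LinearMap.sub_apply, K.lam_cb, K.mu_cb, K.lam_cc, K.mu_cc] at hb' hc'
      rw [hb] at hb'
      rw [hc] at hc'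
      have e1 : ((i + k : ℕ) : ℂ) = ((1 : ℕ) : ℂ) := by push_cast; linear_combination -hb' / 2
      have e2 : ((j + l : ℕ) : ℂ) = ((1 : ℕ) : ℂ) := by push_cast; linear_combination -hc' / 2
      norm_cast at e1 e2
      have hi : i ≤ 1 := by omega
      have hj : j ≤ 1 := by omega
      interval_cases i <;> interval_cases j
      · left; rw [h]; simp
      · right; left; rw [h]; simp
      · right; right; left; rw [h]; simp
      · right; right; right; rw [h]; simp only [one_smul]; abel

end Classify

end LATKeAux

namespace LATKeAux

open Module LieModule LieAlgebra

section Final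

set_option linter.unusedSectionVars false

variable {g : Type} [LieRing g] [LieAlgebra ℂ g]
variable {V : Type} [AddCommGroup V] [Module ℂ V] [LieRingModule g V] [LieModule ℂ g V]
variable [FiniteDimensional ℂ V]
variable {H : LieSubalgebra ℂ g}
variable {D : V →ₗ[ℂ] V →ₗ[ℂ] g}

/-- The four weights of the configuration. -/
def Conf.T (K : Conf D H) (χ : Dual ℂ H) : Prop :=
  χ = K.lam ∨ χ = K.mu ∨ χ = -K.mu ∨ χ = -K.lam

lemma Conf.T.cb {K : Conf D H} {χ : Dual ℂ H} (h : K.T χ) : χ K.cb = 1 ∨ χ K.cb = -1 := by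
  rcases h with rfl | rfl | rfl | rfl <;> simp [K.lam_cb, K.mu_cb]

lemma Conf.T.cc {K : Conf D H} {χ : Dual ℂ H} (h : K.T χ) : χ K.cc = 1 ∨ χ K.cc = -1 := by
  rcases h with rfl | rfl | rfl | rfl <;> simp [K.lam_cc, K.mu_cc]

/-- The span of the four vectors of the configuration. -/
def Conf.U (K : Conf D H) : Submodule ℂ V := Submodule.span ℂ {K.v, K.x, K.y, K.u}

lemma Conf.T.mem {K : Conf D H} {χ : Dual ℂ H} (h : K.T χ) {z : V} (hz : z ∈ Wt H V χ) : z ∈ K.U := by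
  rcases h with rfl | rfl | rfl | rfl
  · obtain ⟨s, rfl⟩ := K.lv z hz
    exact Submodule.smul_mem _ _ (Submodule.subset_span (by simp))
  · obtain ⟨s, rfl⟩ := K.ly z hz
    exact Submodule.smul_mem _ _ (Submodule.subset_span (by simp))
  · obtain ⟨s, rfl⟩ := K.lx z hz
    exact Submodule.smul_mem _ _ (Submodule.subset_span (by simp))
  · obtain ⟨s, rfl⟩ := K.lu z hz
    exact Submodule.smul_mem _ _ (Submodule.subset_span (by simp))

variable [FiniteDimensional ℂ g] [IsKilling ℂ g] [H.IsCartanSubalgebra]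

lemma Sys.mem_of_odd (S : Sys D) (K : Conf D H) {χ : Dual ℂ H} {z : V} (hz : z ∈ Wt H V χ)
    (h : χ K.cb ≠ 0) : z ∈ K.U := by
  by_cases h0 : z = 0
  · rw [h0]; exact zero_mem _
  rcases S.classify K hz h0 with h1 | h1
  · exact absurd h1.1 h
  · exact Conf.T.mem h1 hz

lemma Sys.kill (S : Sys D) (K : Conf D H) {α ω χ : Dual ℂ H} {a w z : V} (ha : a ∈ Wt H V α)
    (hw : w ∈ Wt H V ω) (hz : z ∈ Wt H V χ) (Tα : K.T α) (Tω : K.T ω) (hb : χ K.cb = 0)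
    (hc : χ K.cc = 0) : ⁅D a w, z⁆ = 0 := by
  obtain ⟨c⟩ := S.exists_cst K
  have k1 : ⁅D K.v K.u, z⁆ = 0 := by
    rw [← c.hh, hz c.h, c.eh]; simp [hb, hc]
  have k2 : ⁅D K.x K.y, z⁆ = 0 := by
    rw [← c.hh', hz c.h', c.eh']; simp [hb, hc]
  have k1' : ⁅D K.u K.v, z⁆ = 0 := by rw [S.skew, neg_lie, k1, neg_zero]
  have k2' : ⁅D K.y K.x, z⁆ = 0 := by rw [S.skew, neg_lie, k2, neg_zero]
  by_contra hne
  have hcl := S.classify K (lie_mem_Wt (S.D_mem ha hw) hz) hne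
  have hodd : ¬ K.T (α + ω + χ) := by
    intro hT
    have h1 := hT.cb
    simp only [LinearMap.add_apply, hb] at h1
    rcases Tα.cb with h2 | h2 <;> rcases Tω.cb with h3 | h3 <;> rw [h2, h3] at h1 <;> norm_num at h1
  have h2 := hcl.resolve_right hodd
  simp only [LinearMap.add_apply, hb, hc] at h2
  rcases Tα with rfl | rfl | rfl | rfl <;> rcases Tω with rfl | rfl | rfl | rfl <;>
    simp only [LinearMap.neg_apply, K.lam_cb, K.mu_cb, K.lam_cc, K.mu_cc] at h2 <;> norm_num at h2
  · obtain ⟨s, rfl⟩ := K.lv a ha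
    obtain ⟨r, rfl⟩ := K.lu w hw
    simp [k1] at hne
  · obtain ⟨s, rfl⟩ := K.ly a ha
    obtain ⟨r, rfl⟩ := K.lx w hw
    simp [k2'] at hne
  · obtain ⟨s, rfl⟩ := K.lx a ha
    obtain ⟨r, rfl⟩ := K.ly w hw
    simp [k2] at hne
  · obtain ⟨s, rfl⟩ := K.lu a ha
    obtain ⟨r, rfl⟩ := K.lv w hw
    simp [k1'] at hne

lemma Sys.stable (S : Sys D) (K : Conf D H) {α ω χ : Dual ℂ H} {a w z : V} (ha : a ∈ Wt H V α)
    (hw : w ∈ Wt H V ω) (hz : z ∈ Wt H V χ) (T : K.T χ) : ⁅D a w, z⁆ ∈ K.U := by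
  have hm := lie_mem_Wt (S.D_mem ha hw) hz
  by_cases a0 : a = 0
  · simp [a0]
  by_cases w0 : w = 0
  · simp [w0]
  rcases S.classify K ha a0 with h1 | h1 <;> rcases S.classify K hw w0 with h2 | h2
  · apply S.mem_of_odd K hm
    simp only [LinearMap.add_apply, h1, h2]
    rcases T.cb with h | h <;> rw [h] <;> norm_num
  · rw [S.cyc, S.kill K hw hz ha h2 T h1.1 h1.2]; exact zero_mem _
  · rw [S.alt, S.kill K ha hz hw h1 T h2.1 h2.2, neg_zero]; exact zero_mem _
  · apply S.mem_of_odd K hm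
    simp only [LinearMap.add_apply]
    rcases T.cb with h | h <;> rcases Conf.T.cb (K := K) h1 with h1 | h1 <;>
      rcases Conf.T.cb (K := K) h2 with h2 | h2 <;> rw [h, h1, h2] <;> norm_num

lemma Sys.U_top (S : Sys D) (K : Conf D H) : K.U = ⊤ := by
  refine (S.irr _ ?_).resolve_left ?_
  · intro t z hz
    have ht : t ∈ Submodule.span ℂ {t | ∃ x y, t = D x y} := by rw [S.span]; trivial
    have key : ∀ (χ : Dual ℂ H) (z : V), z ∈ Wt H V χ → K.T χ → ∀ a w : V, ⁅D a w, z⁆ ∈ K.U := by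
      intro χ z hz T a w
      have h1 : a ∈ ⨆ χ : Dual ℂ H, Wt H V χ := by rw [S.iSup_Wt]; trivial
      have h2 : w ∈ ⨆ χ : Dual ℂ H, Wt H V χ := by rw [S.iSup_Wt]; trivial
      induction h1 using Submodule.iSup_induction' with
      | zero => simp
      | add a b _ _ i1 i2 => rw [map_add, LinearMap.add_apply, add_lie]; exact add_mem i1 i2
      | mem α a ha =>
        induction h2 using Submodule.iSup_induction' with
        | zero => simp
        | add a b _ _ i1 i2 => rw [map_add, add_lie]; exact add_mem i1 i2
        | mem ω w hw => exact S.stable K ha hw hz T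
    induction ht using Submodule.span_induction with
    | zero => simp
    | add s t _ _ h1 h2 => rw [add_lie]; exact add_mem h1 h2
    | smul c t _ h => rw [smul_lie]; exact Submodule.smul_mem _ _ h
    | mem t ht =>
      obtain ⟨a, w, rfl⟩ := ht
      induction hz using Submodule.span_induction with
      | zero => simp
      | add s t _ _ h1 h2 => rw [lie_add]; exact add_mem h1 h2
      | smul c t _ h => rw [lie_smul]; exact Submodule.smul_mem _ _ h
      | mem z hz =>
        rcases hz with rfl | rfl | rfl | rfl
        · exact key _ _ K.hv (Or.inl rfl) a w
        · exact key _ _ K.hx (Or.inr (Or.inr (Or.inl rfl))) a w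
        · exact key _ _ K.hy (Or.inr (Or.inl rfl)) a w
        · exact key _ _ K.hu (Or.inr (Or.inr (Or.inr rfl))) a w
  · intro h
    have : K.v ∈ K.U := Submodule.subset_span (by simp)
    rw [h] at this
    exact K.v0 (by simpa using this)

lemma Conf.indep (K : Conf D H) {a b c d : ℂ} (h : a • K.v + b • K.x + c • K.y + d • K.u = 0) :
    a = 0 ∧ b = 0 ∧ c = 0 ∧ d = 0 := by
  have E1 : ∀ a b c d : ℂ, a • K.v + b • K.x + c • K.y + d • K.u = 0 →
      a • K.v + (-b) • K.x + c • K.y + (-d) • K.u = 0 := by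
    intro a b c d h
    have := congrArg (fun z => ⁅(K.cb : g), z⁆) h
    simpa [lie_add, lie_smul, K.hv K.cb, K.hx K.cb, K.hy K.cb, K.hu K.cb, K.lam_cb, K.mu_cb] using this
  have E2 : ∀ a b c d : ℂ, a • K.v + b • K.x + c • K.y + d • K.u = 0 →
      a • K.v + b • K.x + (-c) • K.y + (-d) • K.u = 0 := by
    intro a b c d h
    have := congrArg (fun z => ⁅(K.cc : g), z⁆) h
    simpa [lie_add, lie_smul, K.hv K.cc, K.hx K.cc, K.hy K.cc, K.hu K.cc, K.lam_cc, K.mu_cc] using this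
  have h1 := E1 _ _ _ _ h
  have h2 := E2 _ _ _ _ h
  have h3 := E2 _ _ _ _ h1
  have ha : (4 * a) • K.v = 0 := by linear_combination (norm := module) h + h1 + h2 + h3
  have hb : (4 * b) • K.x = 0 := by linear_combination (norm := module) h - h1 + h2 - h3
  have hc : (4 * c) • K.y = 0 := by linear_combination (norm := module) h + h1 - h2 - h3
  have hd : (4 * d) • K.u = 0 := by linear_combination (norm := module) h - h1 - h2 + h3
  simp [K.v0] at ha
  simp [K.x0] at hb
  simp [K.y0] at hc
  simp [K.u0] at hd
  exact ⟨ha, hb, hc, hd⟩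

lemma Sys.final (S : Sys D) (K : Conf D H) : ∃ W : Basis (Fin 4) ℂ V,
    ⁅D (W 0) (W 1), W 2⁆ = - W 3 ∧ ⁅D (W 0) (W 1), W 3⁆ = W 2 ∧
    ⁅D (W 0) (W 2), W 3⁆ = - W 1 ∧ ⁅D (W 1) (W 2), W 3⁆ = W 0 := by
  obtain ⟨c⟩ := S.exists_cst K
  obtain ⟨p, hp⟩ : ∃ p : ℂ, p = -(1 / (2 * c.m)) := ⟨_, rfl⟩
  obtain ⟨q, hq⟩ : ∃ q : ℂ, q = 1 / (2 * c.n) := ⟨_, rfl⟩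
  have m0 := c.m0
  have n0 := c.n0
  have hpm : p * c.m = -(1 / 2) := by rw [hp]; field_simp
  have hqn : q * c.n = 1 / 2 := by rw [hq]; field_simp
  have p0 : p ≠ 0 := by rintro rfl; norm_num at hpm
  have q0 : q ≠ 0 := by rintro rfl; norm_num at hqn
  have I2 : Complex.I * Complex.I = -1 := Complex.I_mul_I
  let w : Fin 4 → V := ![K.v + p • K.u, Complex.I • (K.v - p • K.u), K.x + q • K.y,
    Complex.I • (K.x - q • K.y)]
  have D01 : D (w 0) (w 1) = (-2 * Complex.I * p) • D K.v K.u := by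
    simp only [w, Matrix.cons_val_zero, Matrix.cons_val_one, map_add, map_sub, map_smul,
      LinearMap.add_apply, LinearMap.smul_apply, S.self, S.skew K.u K.v]
    module
  have D23 : D (w 2) (w 3) = (-2 * Complex.I * q) • D K.x K.y := by
    simp only [w, Matrix.cons_val, map_add, map_sub, map_smul,
      LinearMap.add_apply, LinearMap.smul_apply, S.self, S.skew K.y K.x]
    module
  have hli : LinearIndependent ℂ w := by
    rw [Fintype.linearIndependent_iff]
    intro a ha
    simp only [Fin.sum_univ_four, w, Matrix.cons_val] at ha
    have h1 : (a 0 + a 1 * Complex.I) • K.v + (a 2 + a 3 * Complex.I) • K.x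
        + (q * (a 2 - a 3 * Complex.I)) • K.y + (p * (a 0 - a 1 * Complex.I)) • K.u = 0 := by
      rw [← ha]; module
    obtain ⟨e1, e2, e3, e4⟩ := K.indep h1
    have e3 := (mul_eq_zero.mp e3).resolve_left q0
    have e4 := (mul_eq_zero.mp e4).resolve_left p0
    intro i
    fin_cases i <;> simp only [Fin.zero_eta, Fin.mk_one, Fin.reduceFinMk]
    · linear_combination (e1 + e4) / 2
    · linear_combination -Complex.I * (e1 - e4) / 2 + a 1 * I2
    · linear_combination (e2 + e3) / 2
    · linear_combination -Complex.I * (e2 - e3) / 2 + a 3 * I2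
  have hsp : ⊤ ≤ Submodule.span ℂ (Set.range w) := by
    rw [← S.U_top K, Conf.U, Submodule.span_le]
    have hw : ∀ i, w i ∈ Submodule.span ℂ (Set.range w) := fun i => Submodule.subset_span ⟨i, rfl⟩
    rintro z (rfl | rfl | rfl | rfl)
    · have : K.v = (1 / 2 : ℂ) • w 0 + (-Complex.I / 2) • w 1 := by
        simp only [w, Matrix.cons_val, smul_smul]
        rw [show -Complex.I / 2 * Complex.I = 1 / 2 by linear_combination -I2 / 2]
        module
      rw [this]
      exact add_mem (Submodule.smul_mem _ _ (hw _)) (Submodule.smul_mem _ _ (hw _))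
    · have : K.x = (1 / 2 : ℂ) • w 2 + (-Complex.I / 2) • w 3 := by
        simp only [w, Matrix.cons_val, smul_smul]
        rw [show -Complex.I / 2 * Complex.I = 1 / 2 by linear_combination -I2 / 2]
        module
      rw [this]
      exact add_mem (Submodule.smul_mem _ _ (hw _)) (Submodule.smul_mem _ _ (hw _))
    · have : q • K.y = (1 / 2 : ℂ) • w 2 + (Complex.I / 2) • w 3 := by
        simp only [w, Matrix.cons_val, smul_smul]
        rw [show Complex.I / 2 * Complex.I = -1 / 2 by linear_combination I2 / 2]
        module
      refine (Submodule.smul_mem_iff _ q0).mp ?_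
      rw [this]
      exact add_mem (Submodule.smul_mem _ _ (hw _)) (Submodule.smul_mem _ _ (hw _))
    · have : p • K.u = (1 / 2 : ℂ) • w 0 + (Complex.I / 2) • w 1 := by
        simp only [w, Matrix.cons_val, smul_smul]
        rw [show Complex.I / 2 * Complex.I = -1 / 2 by linear_combination I2 / 2]
        module
      refine (Submodule.smul_mem_iff _ p0).mp ?_
      rw [this]
      exact add_mem (Submodule.smul_mem _ _ (hw _)) (Submodule.smul_mem _ _ (hw _))
  refine ⟨Basis.mk hli hsp, ?_⟩
  simp only [Basis.mk_apply]
  refine ⟨?_, ?_, ?_, ?_⟩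
  · rw [D01]
    simp only [w, Matrix.cons_val, smul_lie, lie_add, lie_smul, c.vux, c.vuy, smul_add, smul_smul,
      smul_sub, neg_add, neg_sub]
    match_scalars
    · linear_combination 2 * Complex.I * hpm
    · linear_combination -2 * Complex.I * q * hpm
  · rw [D01]
    simp only [w, Matrix.cons_val, smul_lie, lie_sub, lie_smul, c.vux, c.vuy, smul_add, smul_smul,
      smul_sub, neg_add, neg_sub]
    match_scalars
    · linear_combination -2 * hpm + 2 * p * c.m * I2
    · linear_combination -2 * q * hpm + 2 * p * c.m * q * I2
  · rw [S.cyc, D23]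
    simp only [w, Matrix.cons_val, smul_lie, lie_add, lie_smul, c.xyv, c.xyu, smul_add, smul_smul,
      smul_sub, neg_add, neg_sub]
    match_scalars
    · linear_combination -2 * Complex.I * hqn
    · linear_combination 2 * Complex.I * p * hqn
  · rw [S.cyc, D23]
    simp only [w, Matrix.cons_val, smul_lie, lie_sub, lie_smul, c.xyv, c.xyu, smul_add, smul_smul,
      smul_sub, neg_add, neg_sub]
    match_scalars
    · linear_combination 2 * hqn - 2 * q * c.n * I2
    · linear_combination 2 * p * hqn - 2 * q * c.n * p * I2

end Final

end LATKeAux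

namespace LATKeAux

open Module LieModule LieAlgebra

attribute [local instance] LieRing.ofAssociativeRing

section Concrete

set_option linter.unusedSectionVars false

variable {L : Type} [AddCommGroup L] [Module ℂ L] [FiniteDimensional ℂ L]

/-- The Lie algebra of inner derivations of a LATKe. -/
def inner3 (b : TriBracket ℂ L) (hjac : Jacobi3 b) : LieSubalgebra ℂ (Module.End ℂ L) where
  toSubmodule := Submodule.span ℂ {t | ∃ x y, t = b x y}
  lie_mem' := by
    intro s t hs ht
    change s ∈ Submodule.span ℂ {t | ∃ x y, t = b x y} at hs
    change t ∈ Submodule.span ℂ {t | ∃ x y, t = b x y} at ht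
    change ⁅s, t⁆ ∈ Submodule.span ℂ {t | ∃ x y, t = b x y}
    induction hs using Submodule.span_induction with
    | zero => rw [zero_lie]; exact zero_mem _
    | add s t _ _ h1 h2 => rw [add_lie]; exact add_mem h1 h2
    | smul c t _ h => rw [smul_lie]; exact Submodule.smul_mem _ _ h
    | mem s hs =>
      obtain ⟨x, y, rfl⟩ := hs
      induction ht using Submodule.span_induction with
      | zero => rw [lie_zero]; exact zero_mem _
      | add s t _ _ h1 h2 => rw [lie_add]; exact add_mem h1 h2
      | smul c t _ h => rw [lie_smul]; exact Submodule.smul_mem _ _ h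
      | mem t ht =>
        obtain ⟨z, w, rfl⟩ := ht
        have : ⁅(b x y : Module.End ℂ L), (b z w : Module.End ℂ L)⁆ = b (b x y z) w + b z (b x y w) := by
          ext a
          rw [LieRing.of_associative_ring_bracket]
          simp only [LinearMap.sub_apply, Module.End.mul_apply, LinearMap.add_apply]
          rw [hjac x y z w a]
          abel
        rw [this]
        exact add_mem (Submodule.subset_span ⟨_, _, rfl⟩) (Submodule.subset_span ⟨_, _, rfl⟩)

/-- The bracket as a map to the inner derivations. -/
noncomputable def innerD (b : TriBracket ℂ L) (hjac : Jacobi3 b) : L →ₗ[ℂ] L →ₗ[ℂ] inner3 b hjac :=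
  LinearMap.mk₂ ℂ (fun x y => ⟨b x y, Submodule.subset_span ⟨x, y, rfl⟩⟩)
    (by intros; ext; simp) (by intros; ext; simp) (by intros; ext; simp) (by intros; ext; simp)

lemma innerD_lie (b : TriBracket ℂ L) (hjac : Jacobi3 b) (x y z : L) :
    ⁅innerD b hjac x y, z⁆ = b x y z := rfl

lemma inner3_lie (b : TriBracket ℂ L) (hjac : Jacobi3 b) (t : inner3 b hjac) (z : L) :
    ⁅t, z⁆ = (t : Module.End ℂ L) z := rfl

lemma innerD_span (b : TriBracket ℂ L) (hjac : Jacobi3 b) :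
    Submodule.span ℂ {t | ∃ x y, t = innerD b hjac x y} = ⊤ := by
  rw [eq_top_iff]
  rintro ⟨t, ht⟩ -
  have ht' : t ∈ Submodule.span ℂ {t : Module.End ℂ L | ∃ x y, t = b x y} := ht
  induction ht' using Submodule.span_induction with
  | zero => exact zero_mem _
  | add s t hs hs' h1 h2 => exact add_mem (h1 hs) (h2 hs')
  | smul c t hs h => exact Submodule.smul_mem _ c (h hs)
  | mem t hs =>
    obtain ⟨x, y, rfl⟩ := hs
    exact Submodule.subset_span ⟨x, y, rfl⟩

lemma inner_deriv (b : TriBracket ℂ L) (hjac : Jacobi3 b) (t : inner3 b hjac) (x y z : L) :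
    ⁅t, b x y z⁆ = b ⁅t, x⁆ y z + b x ⁅t, y⁆ z + b x y ⁅t, z⁆ := by
  have ht : t ∈ Submodule.span ℂ {t | ∃ x y, t = innerD b hjac x y} := by
    rw [innerD_span]; trivial
  induction ht using Submodule.span_induction with
  | zero => simp
  | add s t _ _ h1 h2 =>
    simp only [add_lie, h1, h2, map_add, LinearMap.add_apply]
    abel
  | smul c t _ h => simp only [smul_lie, h, map_smul, LinearMap.smul_apply, smul_add]
  | mem t ht =>
    obtain ⟨p, q, rfl⟩ := ht
    simp only [innerD_lie]
    exact hjac _ _ _ _ _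

lemma inner_sys (b : TriBracket ℂ L) (halt : IsAlt3 b) (hjac : Jacobi3 b)
    (hsimple : IsSimpleLATKe b) : Sys (innerD b hjac) where
  equiv := by
    intro t x y
    apply ext_of_isFaithful (R := ℂ) (M := L)
    intro z
    rw [lie_lie, add_lie]
    simp only [innerD_lie]
    rw [inner_deriv]
    abel
  span := innerD_span b hjac
  skew := by
    intro x y
    apply Subtype.ext
    apply LinearMap.ext
    intro z
    exact halt.1 x y z
  alt := by
    intro x y z
    exact halt.2 x y z
  irr := by
    intro N hN
    apply hsimple.2
    intro x y z hz
    exact hN (innerD b hjac x y) z hz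
  faith := by
    intro t ht
    apply Subtype.ext
    apply LinearMap.ext
    exact ht
  nonz := hsimple.1

theorem exists_basis (b : TriBracket ℂ L) (halt : IsAlt3 b) (hjac : Jacobi3 b)
    (hsimple : IsSimpleLATKe b) : ∃ W : Basis (Fin 4) ℂ L,
    b (W 0) (W 1) (W 2) = - W 3 ∧ b (W 0) (W 1) (W 3) = W 2 ∧
    b (W 0) (W 2) (W 3) = - W 1 ∧ b (W 1) (W 2) (W 3) = W 0 := by
  have S := inner_sys b halt hjac hsimple
  have hnt : Nontrivial L := by
    obtain ⟨x, y, z, h⟩ := S.nonz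
    exact ⟨⟨_, _, h⟩⟩
  have hirr : LieModule.IsIrreducible ℂ (inner3 b hjac) L := by
    apply LieModule.IsIrreducible.mk
    intro N hN
    have := S.irr N.toSubmodule (fun t z hz => N.lie_mem hz)
    rcases this with h | h
    · exact absurd (by simpa using h) hN
    · simpa using h
  have hrad : HasTrivialRadical ℂ (inner3 b hjac) := by
    obtain ⟨hc, h'⟩ := hasCentralRadical_and_of_isIrreducible_of_isFaithful ℂ (inner3 b hjac) L
    rw [hasTrivialRadical_iff, (hasCentralRadical_iff ℂ (inner3 b hjac)).mp inferInstance,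
      LieSubmodule.eq_bot_iff]
    intro t ht
    rw [h' t] at ht
    obtain ⟨c, hc⟩ := Submodule.mem_span_singleton.mp ht
    have hact : ∀ z : L, ⁅t, z⁆ = c • z := by
      intro z
      have := LinearMap.congr_fun hc z
      simpa using this.symm
    apply S.faith
    obtain ⟨x, y, z, hxyz⟩ := hsimple.1
    have h1 := inner_deriv b hjac t x y z
    simp only [hact, map_smul, LinearMap.smul_apply] at h1
    have h2 : (2 * c) • b x y z = 0 := by linear_combination (norm := module) -h1
    have h3 := (smul_eq_zero.mp h2).resolve_right hxyz
    have h4 : c = 0 := by simpa using h3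
    intro z
    rw [hact, h4, zero_smul]
  obtain ⟨x, hx⟩ := exists_isCartanSubalgebra_engel ℂ (inner3 b hjac)
  obtain ⟨K⟩ := S.exists_conf (H := LieSubalgebra.engel ℂ x)
  exact S.final K

end Concrete

lemma alt_vanish {M : Type} [AddCommGroup M] (F : Fin 4 → Fin 4 → Fin 4 → M)
    (hself1 : ∀ i k, F i i k = 0) (hself2 : ∀ i k, F i k k = 0)
    (h1 : ∀ i j k, F i j k = - F j i k) (h2 : ∀ i j k, F i j k = - F i k j)
    (a : F 0 1 2 = 0) (b : F 0 1 3 = 0) (c : F 0 2 3 = 0) (d : F 1 2 3 = 0) :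
    ∀ i j k, F i j k = 0 := by
  have s1 : ∀ {i j k}, F i j k = 0 → F j i k = 0 := by
    intro i j k h; rw [h1, h, neg_zero]
  have s2 : ∀ {i j k}, F i j k = 0 → F i k j = 0 := by
    intro i j k h; rw [h2, h, neg_zero]
  have hself3 : ∀ i k, F i k i = 0 := fun i k => s2 (hself1 i k)
  have six : ∀ i j k, F i j k = 0 → F i j k = 0 ∧ F j i k = 0 ∧ F i k j = 0 ∧ F k i j = 0 ∧
      F j k i = 0 ∧ F k j i = 0 :=
    fun i j k h => ⟨h, s1 h, s2 h, s1 (s2 h), s2 (s1 h), s1 (s2 (s1 h))⟩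
  have a' := six _ _ _ a
  have b' := six _ _ _ b
  have c' := six _ _ _ c
  have d' := six _ _ _ d
  intro i j k
  fin_cases i <;> fin_cases j <;> fin_cases k <;> simp [hself1, hself2, hself3, a', b', c', d']

end LATKeAux

/-- Every finite-dimensional simple LATKe over ℂ is isomorphic, via a linear
bijection preserving the trilinear bracket, to the LATKe `L₃`, i.e. to `ℂ⁴`
equipped with (the unique) trilinear totally antisymmetric bracket `b₃` taking
the prescribed values on the standard basis. -/
theorem unique_simple_LATKe
    {L : Type} [AddCommGroup L] [Module ℂ L] [FiniteDimensional ℂ L]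
    (b : TriBracket ℂ L) (halt : IsAlt3 b) (hjac : Jacobi3 b)
    (hsimple : IsSimpleLATKe b)
    (b₃ : TriBracket ℂ (Fin 4 → ℂ)) (halt₃ : IsAlt3 b₃) (hval₃ : L3Values b₃) :
    ∃ e : L ≃ₗ[ℂ] (Fin 4 → ℂ),
      ∀ x y z : L, e (b x y z) = b₃ (e x) (e y) (e z) := by
  obtain ⟨W, w1, w2, w3, w4⟩ := LATKeAux.exists_basis b halt hjac hsimple
  obtain ⟨v1, v2, v3, v4⟩ := hval₃
  have hE : ∀ i, W.equivFun (W i) = E i := by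
    intro i
    funext j
    rw [W.equivFun_self, E, Pi.single_apply]
    simp [eq_comm]
  refine ⟨W.equivFun, ?_⟩
  have half : ∀ {M : Type} [AddCommGroup M] [Module ℂ M] (p : M), p = -p → p = 0 := by
    intro M _ _ p hp
    have h2 : (2 : ℂ) • p = 0 := by rw [two_smul]; nth_rewrite 1 [hp]; simp
    simpa using h2
  have key := LATKeAux.alt_vanish
    (fun i j k => W.equivFun (b (W i) (W j) (W k)) - b₃ (E i) (E j) (E k))
    (fun i k => by
      rw [half _ (halt.1 (W i) (W i) (W k)), half _ (halt₃.1 (E i) (E i) (E k))]; simp)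
    (fun i k => by
      rw [half _ (halt.2 (W i) (W k) (W k)), half _ (halt₃.2 (E i) (E k) (E k))]; simp)
    (fun i j k => by
      rw [halt.1 (W i), halt₃.1 (E i), map_neg]; abel)
    (fun i j k => by
      rw [halt.2 (W i), halt₃.2 (E i), map_neg]; abel)
    (by rw [w1, v1, map_neg, hE, sub_self])
    (by rw [w2, v2, hE, sub_self])
    (by rw [w3, v3, map_neg, hE, sub_self])
    (by rw [w4, v4, hE, sub_self])
  intro x y z
  have hx : x ∈ Submodule.span ℂ (Set.range W) := by rw [W.span_eq]; trivial
  have hy : y ∈ Submodule.span ℂ (Set.range W) := by rw [W.span_eq]; trivial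
  have hz : z ∈ Submodule.span ℂ (Set.range W) := by rw [W.span_eq]; trivial
  induction hx using Submodule.span_induction with
  | zero => simp
  | add p q _ _ h1 h2 => simp only [map_add, LinearMap.add_apply, h1, h2]
  | smul c p _ h => simp only [map_smul, LinearMap.smul_apply, h]
  | mem p hp =>
    obtain ⟨i, rfl⟩ := hp
    induction hy using Submodule.span_induction with
    | zero => simp
    | add p q _ _ h1 h2 => simp only [map_add, LinearMap.add_apply, h1, h2]
    | smul c p _ h => simp only [map_smul, LinearMap.smul_apply, h]
    | mem p hp =>
      obtain ⟨j, rfl⟩ := hp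
      induction hz using Submodule.span_induction with
      | zero => simp
      | add p q _ _ h1 h2 => simp only [map_add, h1, h2]
      | smul c p _ h => simp only [map_smul, h]
      | mem p hp =>
        obtain ⟨k, rfl⟩ := hp
        rw [hE, hE, hE]
        exact sub_eq_zero.mp (key i j k)
end

section
/- If L is a finite-dimensional simple LATKe over ℂ, then every derivation of L is an inner derivation: Der(L) = IDer(L). -/
variable {k L : Type*} [Field k] [AddCommGroup L] [Module k L]

/-- The space `IDer(L)` of inner derivations of a LATKe: the span of the maps
`ad(x∧y) = (z ↦ [x, y, z]) = b x y`. -/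
def IDer (b : TriBracket k L) : Submodule k (L →ₗ[k] L) :=
  Submodule.span k {f : L →ₗ[k] L | ∃ x y : L, f = b x y}

/-- A derivation of a LATKe: a linear map `D` with
`D [x,y,z] = [Dx,y,z] + [x,Dy,z] + [x,y,Dz]`. -/
def IsDeriv3 (b : TriBracket k L) (D : L →ₗ[k] L) : Prop :=
  ∀ x y z : L, D (b x y z) = b (D x) y z + b x (D y) z + b x y (D z)

attribute [local instance] LieRing.ofAssociativeRing

theorem IDer_isDeriv {L : Type*} [AddCommGroup L] [Module ℂ L] (b : TriBracket ℂ L)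
    (hjac : Jacobi3 b) {D : L →ₗ[ℂ] L} (hD : D ∈ IDer b) : IsDeriv3 b D := by
  unfold IDer at hD
  induction hD using Submodule.span_induction with
  | mem f hf =>
    obtain ⟨x, y, rfl⟩ := hf
    exact fun z₁ z₂ z₃ => hjac x y z₁ z₂ z₃
  | zero => intro x y z; simp
  | add f g _ _ hf hg =>
    intro x y z
    simp only [LinearMap.add_apply, map_add, hf x y z, hg x y z]
    abel
  | smul c f _ hf =>
    intro x y z
    simp only [LinearMap.smul_apply, map_smul, hf x y z, smul_add]

theorem deriv_lie_mem {L : Type*} [AddCommGroup L] [Module ℂ L] (b : TriBracket ℂ L)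
    {D T : Module.End ℂ L} (hD : IsDeriv3 b D) (hT : T ∈ IDer b) :
    ⁅D, T⁆ ∈ IDer b := by
  unfold IDer at hT
  induction hT using Submodule.span_induction with
  | mem f hf =>
    obtain ⟨x, y, rfl⟩ := hf
    have : ⁅D, (b x y : Module.End ℂ L)⁆ = b (D x) y + b x (D y) := by
      refine LinearMap.ext fun z => ?_
      have := hD x y z
      simp only [Ring.lie_def, LinearMap.sub_apply, Module.End.mul_apply, LinearMap.add_apply]
      rw [this]; abel
    rw [this]
    exact add_mem (Submodule.subset_span ⟨_, _, rfl⟩) (Submodule.subset_span ⟨_, _, rfl⟩)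
  | zero => rw [lie_zero]; exact zero_mem _
  | add f g _ _ hf hg => rw [lie_add]; exact add_mem hf hg
  | smul c f _ hf => rw [lie_smul]; exact Submodule.smul_mem _ _ hf

theorem scalar_deriv {L : Type*} [AddCommGroup L] [Module ℂ L] (b : TriBracket ℂ L)
    (hne : ∃ x y z : L, b x y z ≠ 0) {D : L →ₗ[ℂ] L} (hD : IsDeriv3 b D) (c : ℂ)
    (hc : ∀ x, D x = c • x) : c = 0 := by
  obtain ⟨x, y, z, h⟩ := hne
  have h1 := hD x y z
  simp only [hc, map_smul, LinearMap.smul_apply] at h1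
  have h2 : (2 * c) • b x y z = 0 := by
    have h3 : (2 * c) • b x y z
      = (c • b x y z + c • b x y z + c • b x y z) - c • b x y z := by module
    rw [h3, ← h1, sub_self]
  simpa [h] using h2

/-- The inner derivations as a Lie algebra of endomorphisms. -/
noncomputable def IDerLie {L : Type*} [AddCommGroup L] [Module ℂ L] (b : TriBracket ℂ L)
    (hjac : Jacobi3 b) : LieSubalgebra ℂ (Module.End ℂ L) :=
  { IDer b with
    lie_mem' := fun {_ _} hx hy => deriv_lie_mem b (IDer_isDeriv b hjac hx) hy }

/-- Commutator with a derivation, as a derivation of the Lie algebra of inner derivations. -/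
noncomputable def commDer {L : Type*} [AddCommGroup L] [Module ℂ L] (b : TriBracket ℂ L)
    (hjac : Jacobi3 b) (D : Module.End ℂ L) (hD : IsDeriv3 b D) :
    LieDerivation ℂ (IDerLie b hjac) (IDerLie b hjac) where
  toFun T := ⟨⁅D, (T : Module.End ℂ L)⁆, deriv_lie_mem b hD T.2⟩
  map_add' S T := Subtype.ext (lie_add _ _ _)
  map_smul' c T := Subtype.ext (lie_smul _ _ _)
  leibniz' S T := by
    refine Subtype.ext ?_
    change ⁅D, ⁅(S : Module.End ℂ L), (T : Module.End ℂ L)⁆⁆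
      = ⁅(S : Module.End ℂ L), ⁅D, (T : Module.End ℂ L)⁆⁆
        - ⁅(T : Module.End ℂ L), ⁅D, (S : Module.End ℂ L)⁆⁆
    rw [leibniz_lie D, ← lie_skew (T : Module.End ℂ L)]
    abel

theorem Der_eq_IDer {L : Type*} [AddCommGroup L] [Module ℂ L]
    [FiniteDimensional ℂ L] (b : TriBracket ℂ L)
    (halt : IsAlt3 b) (hjac : Jacobi3 b) (hsimple : IsSimpleLATKe b) :
    ∀ D : L →ₗ[ℂ] L, IsDeriv3 b D ↔ D ∈ IDer b := by
  intro D
  refine ⟨fun hD => ?_, IDer_isDeriv b hjac⟩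
  obtain ⟨hne, hid⟩ := hsimple
  have hnt : Nontrivial L := by
    obtain ⟨x, y, z, h⟩ := hne
    exact ⟨_, _, h⟩
  let g := IDerLie b hjac
  have hirr : LieModule.IsIrreducible ℂ g L := by
    refine LieModule.IsIrreducible.mk fun N hN => ?_
    have := hid N.toSubmodule (fun x y z hz =>
      N.lie_mem (x := (⟨b x y, Submodule.subset_span ⟨x, y, rfl⟩⟩ : g)) hz)
    rcases this with h | h
    · exact absurd (by simpa using h) hN
    · simpa using h
  have hfaith : LieModule.IsFaithful ℂ g L := by
    refine ⟨fun S T h => Subtype.ext ?_⟩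
    exact h
  have hrad : LieAlgebra.HasTrivialRadical ℂ g := by
    obtain ⟨_i, h'⟩ := LieAlgebra.hasCentralRadical_and_of_isIrreducible_of_isFaithful ℂ g L
    rw [LieAlgebra.hasTrivialRadical_iff,
      (LieAlgebra.hasCentralRadical_iff ℂ g).mp inferInstance, LieSubmodule.eq_bot_iff]
    intro x hx
    rw [h' x] at hx
    obtain ⟨t, ht⟩ := Submodule.mem_span_singleton.mp hx
    have hx' : ∀ v, (x : Module.End ℂ L) v = t • v := fun v => (LinearMap.congr_fun ht v).symm
    have ht0 := scalar_deriv b hne (IDer_isDeriv b hjac x.2) t hx'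
    refine Subtype.ext (LinearMap.ext fun v => ?_)
    rw [hx' v, ht0, zero_smul]; rfl
  obtain ⟨S, hS⟩ := LieDerivation.IsKilling.exists_eq_ad (commDer b hjac D hD)
  have hcomm : ∀ x y v, D (b x y v) - b x y (D v)
      = (S : Module.End ℂ L) (b x y v) - b x y ((S : Module.End ℂ L) v) := by
    intro x y v
    let T : g := ⟨b x y, Submodule.subset_span ⟨x, y, rfl⟩⟩
    have h1 : LieDerivation.ad ℂ g S T = commDer b hjac D hD T := by rw [hS]
    have h2 : LieDerivation.ad ℂ g S T = ⁅S, T⁆ :=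
      LinearMap.congr_fun (LieDerivation.coe_ad_apply_eq_ad_apply (R := ℂ) S) T
    rw [h2] at h1
    have h3 := congrArg (fun U : g => (U : Module.End ℂ L) v) h1
    exact h3.symm
  let E : Module.End ℂ L := D - (S : Module.End ℂ L)
  have hE : IsDeriv3 b E := by
    intro x y z
    have h1 := hD x y z
    have h2 := IDer_isDeriv b hjac S.2 x y z
    simp only [E, LinearMap.sub_apply, map_sub]
    rw [h1, h2]; abel
  obtain ⟨μ, hμ⟩ := Module.End.exists_eigenvalue E
  have htop : E.eigenspace μ = ⊤ := by
    refine (hid (E.eigenspace μ) ?_).resolve_left hμ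
    intro x y z hz
    rw [Module.End.mem_eigenspace_iff] at hz ⊢
    rw [← map_smul, ← hz]
    have := hcomm x y z
    simp only [E, LinearMap.sub_apply, map_sub]
    rw [sub_eq_sub_iff_add_eq_add] at this ⊢
    rw [this]; abel
  have hsc : ∀ v, E v = μ • v := fun v =>
    Module.End.mem_eigenspace_iff.mp (htop ▸ Submodule.mem_top)
  have h0 := scalar_deriv b hne hE μ hsc
  have hDS : D = (S : Module.End ℂ L) := by
    refine LinearMap.ext fun v => ?_
    have := hsc v
    rw [h0, zero_smul] at this
    exact sub_eq_zero.mp this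
  rw [hDS]
  exact S.2
end

section
/- Let g be a finite-dimensional semisimple Lie algebra over ℂ with a faithful finite-dimensional irreducible representation V whose exterior square Λ²V is isomorphic as a g-module to the adjoint representation of g. Fix a Cartan subalgebra of g and a system of positive roots, and let Λ be the highest weight of V. Then for every simple ideal s of g, the highest root θ of s satisfies θ + α = 2Λ for some simple positive root α; equivalently, θ is the sum of the highest weight Λ of V and the next-to-highest weight Λ − α of V. -/
open LieAlgebra LieModule

namespace HighestRootAux

set_option linter.unusedSectionVars false

section Comb
variable {X : Type*} {R P : Set (X → ℂ)}

/-- Existence of coroots with integrality and the root string property. -/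
def HasCoroots (R : Set (X → ℂ)) : Prop :=
  ∀ α ∈ R, ∃ x : X, α x = 2 ∧ ∀ β ∈ R, ∃ n : ℤ, β x = n ∧
    (n < 0 → β + α ≠ 0 → β + α ∈ R) ∧ (0 < n → β ≠ α → β - α ∈ R)

/-- Positive systems. -/
structure IsPos (R P : Set (X → ℂ)) : Prop where
  cor : HasCoroots R
  neg : ∀ α ∈ R, -α ∈ R
  sub : P ⊆ R
  choice : ∀ α ∈ R, (α ∈ P ↔ ¬ (-α ∈ P))
  add : ∀ α ∈ P, ∀ β ∈ P, α + β ∈ R → α + β ∈ P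

lemma exists_nonneg_sum (x : X) (s : Multiset (X → ℂ))
    (hx : ∀ β ∈ s, ∃ n : ℤ, β x = n ∧ 0 ≤ n) : ∃ n : ℤ, s.sum x = n ∧ 0 ≤ n := by
  induction s using Multiset.induction_on with
  | empty => exact ⟨0, by simp⟩
  | cons a s ih =>
    obtain ⟨n, hn, hn0⟩ := ih (fun b hb => hx b (by simp [hb]))
    obtain ⟨m, hm, hm0⟩ := hx a (by simp)
    exact ⟨m + n, by simp [hn, hm], by omega⟩

lemma exists_nonpos_sum (x : X) (s : Multiset (X → ℂ))
    (hx : ∀ β ∈ s, ∃ n : ℤ, β x = n ∧ n ≤ 0) : ∃ n : ℤ, s.sum x = n ∧ n ≤ 0 := by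
  induction s using Multiset.induction_on with
  | empty => exact ⟨0, by simp⟩
  | cons a s ih =>
    obtain ⟨n, hn, hn0⟩ := ih (fun b hb => hx b (by simp [hb]))
    obtain ⟨m, hm, hm0⟩ := hx a (by simp)
    exact ⟨m + n, by simp [hn, hm], by omega⟩

lemma sum_ne_zero (h : IsPos R P) : ∀ (k : ℕ) (s : Multiset (X → ℂ)), s.card = k → s ≠ 0 →
    (∀ b ∈ s, b ∈ P) → s.sum ≠ 0 := by
  intro k
  induction k using Nat.strong_induction_on with
  | _ k ih =>
  intro s hk hs0 hsP hsum
  obtain ⟨a, ha⟩ := Multiset.exists_mem_of_ne_zero hs0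
  obtain ⟨t, rfl⟩ := Multiset.exists_cons_of_mem ha
  obtain ⟨x, hx2, hx⟩ := h.cor a (h.sub (hsP a ha))
  by_cases hneg : ∃ b ∈ t, ∃ n : ℤ, b x = n ∧ n < 0
  · obtain ⟨b, hb, n, hn, hn0⟩ := hneg
    have hbP : b ∈ P := hsP b (by simp [hb])
    have haP : a ∈ P := hsP a (by simp)
    obtain ⟨u, rfl⟩ := Multiset.exists_cons_of_mem hb
    obtain ⟨m, hm, hm1, -⟩ := hx b (h.sub hbP)
    have hmn : m = n := by exact_mod_cast hm.symm.trans hn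
    subst hmn
    have hba : b + a ≠ 0 := by
      intro h0
      have : b = -a := eq_neg_of_add_eq_zero_left h0
      subst this
      exact (h.choice a (h.sub haP)).1 haP hbP
    have hbaP := h.add b hbP a haP (hm1 hn0 hba)
    refine ih ((b + a) ::ₘ u).card ?_ ((b + a) ::ₘ u) rfl (Multiset.cons_ne_zero) ?_ ?_
    · simp at hk ⊢; omega
    · intro c hc
      rcases Multiset.mem_cons.1 hc with rfl | hc
      · exact hbaP
      · exact hsP c (by simp [hc])
    · simp only [Multiset.sum_cons] at hsum ⊢
      rw [← hsum]; abel
  · push Not at hneg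
    obtain ⟨n, hn, hn0⟩ := exists_nonneg_sum x t (fun b hb => by
      obtain ⟨m, hm, -⟩ := hx b (h.sub (hsP b (by simp [hb])))
      exact ⟨m, hm, hneg b hb m hm⟩)
    have := congrFun hsum x
    simp [hx2, hn] at this
    have h2 : (2 + n : ℤ) = 0 := by exact_mod_cast this
    omega

lemma exists_multiset {q : X → ℂ} (hq : q ∈ AddSubmonoid.closure P) :
    ∃ s : Multiset (X → ℂ), (∀ b ∈ s, b ∈ P) ∧ s.sum = q :=
  AddSubmonoid.exists_multiset_of_mem_closure hq

lemma eq_zero_of_add (h : IsPos R P) {q r : X → ℂ} (hq : q ∈ AddSubmonoid.closure P)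
    (hr : r ∈ AddSubmonoid.closure P) (h0 : q + r = 0) : q = 0 := by
  obtain ⟨s, hs, rfl⟩ := exists_multiset hq
  obtain ⟨t, ht, rfl⟩ := exists_multiset hr
  by_contra hne
  refine sum_ne_zero h _ (s + t) rfl ?_ ?_ (by simpa using h0)
  · rintro h1
    have : s = 0 := by
      have := congrArg Multiset.card h1
      simp at this
      exact this.1
    simp [this] at hne
  · intro b hb
    rcases Multiset.mem_add.1 hb with hb | hb
    · exact hs b hb
    · exact ht b hb

lemma ne_zero_of_mem (h : IsPos R P) {a : X → ℂ} (ha : a ∈ P) : a ≠ 0 := by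
  have := sum_ne_zero h 1 {a} (by simp) (by simp) (by simpa using ha)
  simpa using this

lemma indecomposable (h : IsPos R P) {α q : X → ℂ} (hα : α ∈ P)
    (hs : ¬ ∃ β ∈ P, ∃ γ ∈ P, α = β + γ)
    (hq : q ∈ AddSubmonoid.closure P) (hr : α - q ∈ AddSubmonoid.closure P) :
    q = 0 ∨ q = α := by
  obtain ⟨s, hsP, rfl⟩ := exists_multiset hq
  obtain ⟨t, htP, ht⟩ := exists_multiset hr
  by_cases hs0 : s = 0
  · left; simp [hs0]
  by_cases ht0 : t = 0
  · right; simp [ht0] at ht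
    exact (sub_eq_zero.1 ht.symm).symm
  exfalso
  have hst : (s + t).sum = α := by simp [ht]
  have hcard : 2 ≤ (s + t).card := by
    have h1 := Multiset.card_pos.2 hs0
    have h2 := Multiset.card_pos.2 ht0
    simp; omega
  have hP : ∀ b ∈ s + t, b ∈ P := by
    intro b hb
    rcases Multiset.mem_add.1 hb with hb | hb
    · exact hsP b hb
    · exact htP b hb
  generalize s + t = w at hst hcard hP
  obtain ⟨x, hx2, hx⟩ := h.cor α (h.sub hα)
  by_cases hpos : ∃ b ∈ w, ∃ n : ℤ, b x = n ∧ 0 < n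
  · obtain ⟨b, hb, n, hn, hn0⟩ := hpos
    obtain ⟨u, rfl⟩ := Multiset.exists_cons_of_mem hb
    have hbP := hP b hb
    obtain ⟨m, hm, -, hm1⟩ := hx b (h.sub hbP)
    have hmn : m = n := by exact_mod_cast hm.symm.trans hn
    subst hmn
    have hu0 : u ≠ 0 := by
      rintro rfl
      simp at hcard
    have huP : ∀ c ∈ u, c ∈ P := fun c hc => hP c (by simp [hc])
    rw [Multiset.sum_cons] at hst
    have hne : b ≠ α := by
      rintro rfl
      exact sum_ne_zero h _ u rfl hu0 huP (by simpa using hst)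
    have hR := hm1 hn0 hne
    by_cases hbα : b - α ∈ P
    · refine sum_ne_zero h _ ((b - α) ::ₘ u) rfl Multiset.cons_ne_zero ?_ ?_
      · intro c hc
        rcases Multiset.mem_cons.1 hc with rfl | hc
        · exact hbα
        · exact huP c hc
      · rw [Multiset.sum_cons, ← hst]; abel
    · have : α - b ∈ P := by
        by_contra hc
        exact hbα ((h.choice _ hR).2 (by simpa using hc))
      exact hs ⟨b, hbP, _, this, by abel⟩
  · push Not at hpos
    obtain ⟨n, hn, hn0⟩ := exists_nonpos_sum x w (fun b hb => by
      obtain ⟨m, hm, -⟩ := hx b (h.sub (hP b hb))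
      exact ⟨m, hm, hpos b hb m hm⟩)
    rw [hst, hx2] at hn
    have h2 : (2 : ℤ) = n := by exact_mod_cast hn
    omega

lemma exists_simple (h : IsPos R P) (hfin : P.Finite) (T : (X → ℂ) → Prop)
    (hT : ∀ β ∈ P, ∀ γ ∈ P, β + γ ∈ P → T (β + γ) → T β ∨ T γ) (hex : ∃ β ∈ P, T β) :
    ∃ α ∈ P, (¬ ∃ β ∈ P, ∃ γ ∈ P, α = β + γ) ∧ T α := by
  have : Finite P := hfin
  let r : P → P → Prop := fun a b => b.1 - a.1 ∈ AddSubmonoid.closure P ∧ b.1 ≠ a.1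
  have : IsTrans P r := ⟨fun a b c hab hbc => by
    refine ⟨?_, fun hca => ?_⟩
    · have := add_mem hbc.1 hab.1
      simpa using this
    · have := eq_zero_of_add h hab.1 hbc.1 (by rw [hca]; abel)
      exact hab.2 (sub_eq_zero.1 this)⟩
  have : Std.Irrefl r := ⟨fun a ha => ha.2 rfl⟩
  have wf : WellFounded r := Finite.wellFounded_of_trans_of_irrefl r
  obtain ⟨β, hβ, hTβ⟩ := hex
  obtain ⟨a, haT, hmin⟩ := wf.has_min {a : P | T a.1} ⟨⟨β, hβ⟩, hTβ⟩
  refine ⟨a.1, a.2, ?_, haT⟩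
  rintro ⟨β, hβ, γ, hγ, hsum⟩
  have haT' : T (β + γ) := hsum ▸ haT
  rcases hT β hβ γ hγ (hsum ▸ a.2) haT' with h1 | h1
  · refine hmin ⟨β, hβ⟩ h1 ⟨?_, ?_⟩
    · simpa [hsum] using AddSubmonoid.subset_closure hγ
    · simpa [hsum] using ne_zero_of_mem h hγ
  · refine hmin ⟨γ, hγ⟩ h1 ⟨?_, ?_⟩
    · simpa [hsum] using AddSubmonoid.subset_closure hβ
    · simpa [hsum] using ne_zero_of_mem h hβ

end Comb

section Lie
variable {g : Type*} [LieRing g] [LieAlgebra ℂ g] [FiniteDimensional ℂ g]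
  [LieAlgebra.IsKilling ℂ g] (H : LieSubalgebra ℂ g) [H.IsCartanSubalgebra]

/-- The set of roots. -/
def rts : Set (H → ℂ) := {β | β ≠ 0 ∧ rootSpace H β ≠ ⊥}

variable {H}

lemma exists_weight {β : H → ℂ} (hβ : β ∈ rts H) :
    ∃ χ : Weight ℂ H g, χ.IsNonZero ∧ (χ : H → ℂ) = β :=
  ⟨⟨β, hβ.2⟩, fun h => hβ.1 h, rfl⟩

lemma weight_mem_rts {χ : Weight ℂ H g} (h : χ.IsNonZero) : (χ : H → ℂ) ∈ rts H :=
  ⟨fun h0 => h h0, χ.genWeightSpace_ne_bot⟩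

lemma neg_mem_rts {β : H → ℂ} (hβ : β ∈ rts H) : -β ∈ rts H := by
  obtain ⟨χ, h, rfl⟩ := exists_weight hβ
  have := weight_mem_rts (Weight.IsNonZero.neg h)
  simpa using this

lemma rts_finite : (rts H).Finite :=
  (finite_genWeightSpace_ne_bot ℂ H g).subset fun _ h => h.2

lemma hasCoroots : HasCoroots (rts H) := by
  intro α hα
  obtain ⟨χ, hχ, rfl⟩ := exists_weight hα
  refine ⟨IsKilling.coroot χ, IsKilling.root_apply_coroot hχ, ?_⟩
  intro β hβ
  obtain ⟨ψ, hψ, rfl⟩ := exists_weight hβ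
  let S := IsKilling.rootSystem H
  let i : H.root := ⟨ψ, by simpa [LieSubalgebra.root] using hψ⟩
  let j : H.root := ⟨χ, by simpa [LieSubalgebra.root] using hχ⟩
  have key : ((S.pairingIn ℤ i j : ℤ) : ℂ) = ψ (IsKilling.coroot χ) := by
    have : ((S.pairingIn ℤ i j : ℤ) : ℂ) = S.pairing i j := by
      simpa using S.algebraMap_pairingIn ℤ i j
    exact this
  refine ⟨S.pairingIn ℤ i j, key.symm, ?_, ?_⟩
  · intro h1 h2
    have := S.root_add_root_mem_of_pairingIn_neg h1 (by
      intro h3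
      apply h2
      funext x
      have := LinearMap.congr_fun h3 x
      simp [S, i, j] at this
      simp [this])
    obtain ⟨k, hk⟩ := this
    have hk' : ((k : Weight ℂ H g) : H → ℂ) = ψ + χ := by
      funext x
      have := LinearMap.congr_fun hk x
      simpa [S, i, j] using this
    rw [← hk']
    exact weight_mem_rts (H.isNonZero_coe_root k)
  · intro h1 h2
    have := S.root_sub_root_mem_of_pairingIn_pos h1 (by
      intro h3
      apply h2
      have : ψ = χ := congrArg Subtype.val h3
      rw [this])
    obtain ⟨k, hk⟩ := this
    have hk' : ((k : Weight ℂ H g) : H → ℂ) = ψ - χ := by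
      funext x
      have := LinearMap.congr_fun hk x
      simpa [S, i, j] using this
    rw [← hk']
    exact weight_mem_rts (H.isNonZero_coe_root k)

open Classical in
/-- The Killing dual of a root. -/
noncomputable def tv (β : H → ℂ) : H :=
  if h : ∃ l : Module.Dual ℂ H, (l : H → ℂ) = β then
    (IsKilling.cartanEquivDual H).symm h.choose else 0

lemma tv_coe (l : Module.Dual ℂ H) : tv (l : H → ℂ) = (IsKilling.cartanEquivDual H).symm l := by
  have h : ∃ l' : Module.Dual ℂ H, (l' : H → ℂ) = (l : H → ℂ) := ⟨l, rfl⟩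
  rw [tv, dif_pos h]
  congr 1
  exact DFunLike.coe_injective h.choose_spec

lemma tv_weight (χ : Weight ℂ H g) :
    tv (χ : H → ℂ) = (IsKilling.cartanEquivDual H).symm χ.toLinear := by
  rw [← tv_coe]; rfl

lemma tv_add {β γ : H → ℂ} (hβ : β ∈ rts H) (hγ : γ ∈ rts H) :
    tv (β + γ) = tv β + tv γ := by
  obtain ⟨χ, -, rfl⟩ := exists_weight hβ
  obtain ⟨ψ, -, rfl⟩ := exists_weight hγ
  rw [tv_weight, tv_weight, ← map_add, ← tv_coe]; rfl

lemma tv_neg {β : H → ℂ} (hβ : β ∈ rts H) : tv (-β) = - tv β := by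
  obtain ⟨χ, -, rfl⟩ := exists_weight hβ
  rw [tv_weight, ← map_neg, ← tv_coe]; rfl

lemma tv_self {β : H → ℂ} (hβ : β ∈ rts H) : β (tv β) ≠ 0 := by
  obtain ⟨χ, h, rfl⟩ := exists_weight hβ
  rw [tv_weight]
  exact IsKilling.root_apply_cartanEquivDual_symm_ne_zero h

lemma apply_tv (χ : Weight ℂ H g) (x : H) :
    χ x = traceForm ℂ H g (tv (χ : H → ℂ)) x := by
  rw [tv_weight]
  have : IsKilling.cartanEquivDual H ((IsKilling.cartanEquivDual H).symm χ.toLinear) x = χ x := by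
    rw [LinearEquiv.apply_symm_apply, Weight.toLinear_apply]
  rw [← this, IsKilling.cartanEquivDual_apply_apply]
  rfl

lemma tv_symm {β γ : H → ℂ} (hβ : β ∈ rts H) (hγ : γ ∈ rts H) : β (tv γ) = γ (tv β) := by
  obtain ⟨χ, -, rfl⟩ := exists_weight hβ
  obtain ⟨ψ, -, rfl⟩ := exists_weight hγ
  rw [apply_tv χ, apply_tv ψ, traceForm_comm]

lemma coroot_eq_tv (χ : Weight ℂ H g) :
    IsKilling.coroot χ = (2 * (χ (tv (χ : H → ℂ)))⁻¹) • tv (χ : H → ℂ) := by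
  rw [tv_weight, IsKilling.coroot, mul_smul, two_smul, two_smul]

variable (s : LieIdeal ℂ g)

/-- Root space contained in an ideal. -/
def InS (β : H → ℂ) : Prop := (rootSpace H β : Submodule ℂ g) ≤ (s : Submodule ℂ g)

lemma tv_mem {β : H → ℂ} (hβ : β ∈ rts H) (h : InS s β) : (tv β : g) ∈ s := by
  obtain ⟨χ, h0, rfl⟩ := exists_weight hβ
  have h1 : (IsKilling.coroot χ : g) ∈ s :=
    LieIdeal.corootSubmodule_le s (α := χ) h (IsKilling.coe_coroot_mem_corootSubmodule χ)
  have h2 : tv (χ : H → ℂ) = ((2 * (χ (tv (χ : H → ℂ)))⁻¹)⁻¹) • IsKilling.coroot χ := by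
    rw [coroot_eq_tv, smul_smul, inv_mul_cancel₀, one_smul]
    have := tv_self hβ
    simpa using this
  rw [h2]
  exact s.smul_mem _ h1

lemma vanish {β : H → ℂ} (h : ¬ InS s β) (x : H) (hx : (x : g) ∈ s) : β x = 0 := by
  by_contra hne
  apply h
  intro y hy
  have h1 : β x • y ∈ s.toSubmodule := by
    rw [← IsKilling.lie_eq_smul_of_mem_rootSpace hy x]
    exact lie_mem_left ℂ g s x y hx
  exact (s.toSubmodule.smul_mem_iff hne).mp h1

lemma not_both {β : H → ℂ} (hβ : β ∈ rts H) (h : InS s β)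
    (h' : ∀ x : H, (x : g) ∈ s → β x = 0) : False :=
  tv_self hβ (h' _ (tv_mem s hβ h))

lemma inS_of_add_left {β γ : H → ℂ} (hβ : β ∈ rts H) (hγ : γ ∈ rts H) (hs : β + γ ∈ rts H)
    (h : InS s (β + γ)) : InS s β := by
  by_contra hn
  by_cases hd : InS s γ
  · apply tv_self hβ
    apply vanish s hn
    have h1 := tv_mem s hs h
    have h2 := tv_mem s hγ hd
    rw [tv_add hβ hγ] at h1
    have := sub_mem h1 h2
    simpa using this
  · exact not_both s hs h fun x hx => by simp [vanish s hn x hx, vanish s hd x hx]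

lemma not_inS_of_add_left {β γ : H → ℂ} (hβ : β ∈ rts H) (hγ : γ ∈ rts H) (hs : β + γ ∈ rts H)
    (h : ¬ InS s (β + γ)) : ¬ InS s β := by
  intro hn
  by_cases hd : InS s γ
  · apply tv_self hs
    apply vanish s h
    rw [tv_add hβ hγ]
    simpa using add_mem (tv_mem s hβ hn) (tv_mem s hγ hd)
  · refine not_both s hβ hn fun x hx => ?_
    have h1 := vanish s h x hx
    simpa [vanish s hd x hx] using h1

lemma inS_neg {β : H → ℂ} (hβ : β ∈ rts H) (h : InS s β) : InS s (-β) := by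
  by_contra hn
  refine not_both s hβ h fun x hx => ?_
  simpa using vanish s hn x hx

end Lie

section Rep
variable {g : Type*} [LieRing g] [LieAlgebra ℂ g] [FiniteDimensional ℂ g]
  [LieAlgebra.IsKilling ℂ g] {H : LieSubalgebra ℂ g} [H.IsCartanSubalgebra]
  {V : Type*} [AddCommGroup V] [Module ℂ V] [LieRingModule g V]
  [LieModule ℂ g V] [FiniteDimensional ℂ V]

/-- `w` is a (possibly zero) weight vector of weight `μ`. -/
def Eig (μ : H → ℂ) (w : V) : Prop := ∀ h : H, ⁅(h : g), w⁆ = μ h • w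

lemma Eig.mem {μ : H → ℂ} {w : V} (h : Eig μ w) : w ∈ genWeightSpace V μ :=
  (mem_genWeightSpace V μ w).mpr fun x ↦ ⟨1, by
    have := h x
    simp [this]⟩

lemma Eig.lie {μ β : H → ℂ} {w : V} {x : g} (h : Eig μ w) (hx : x ∈ rootSpace H β) :
    Eig (β + μ) ⁅x, w⁆ := by
  intro y
  have h1 : ⁅(y : g), x⁆ = β y • x := IsKilling.lie_eq_smul_of_mem_rootSpace hx y
  rw [leibniz_lie, h1, h y, smul_lie, lie_smul, Pi.add_apply, add_smul]

lemma Eig.omega {μ ν : H → ℂ} {u w : V} (ω : V →ₗ[ℂ] V →ₗ[ℂ] g)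
    (hω : ∀ (x : g) (u v : V), ⁅x, ω u v⁆ = ω ⁅x, u⁆ v + ω u ⁅x, v⁆)
    (hu : Eig μ u) (hw : Eig ν w) : Eig (μ + ν) (ω u w) := by
  intro y
  rw [hω, hu y, hw y]
  simp [add_smul]

/-- Vectors reachable from `v` by applying elements of `Y`. -/
inductive Reach (Y : Set g) (v : V) : V → Prop
  | base : Reach Y v v
  | step (y : g) (w : V) : y ∈ Y → Reach Y v w → Reach Y v ⁅y, w⁆

lemma lie_span_reach {Y : Set g} {v : V}
    (hY : ∀ x : g, x ∈ Submodule.span ℂ (Y ∪ {b | ∃ c : ℂ, ⁅b, v⁆ = c • v})) (w : V)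
    (hw : Reach Y v w) : ∀ x : g, ⁅x, w⁆ ∈ Submodule.span ℂ {w | Reach Y v w} := by
  induction hw with
  | base =>
    intro x
    induction hY x using Submodule.span_induction with
    | mem x hx =>
      rcases hx with hx | ⟨c, hc⟩
      · exact Submodule.subset_span (Reach.step x v hx Reach.base)
      · rw [hc]
        exact Submodule.smul_mem _ _ (Submodule.subset_span Reach.base)
    | zero => simp
    | add x y _ _ hx hy => rw [add_lie]; exact add_mem hx hy
    | smul c x _ hx => rw [smul_lie]; exact Submodule.smul_mem _ _ hx
  | step y w hy hw ih =>
    intro x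
    rw [leibniz_lie]
    refine add_mem (ih _) ?_
    have hz := ih x
    generalize ⁅x, w⁆ = z at hz ⊢
    induction hz using Submodule.span_induction with
    | mem z hz => exact Submodule.subset_span (Reach.step y z hy hz)
    | zero => simp
    | add a b _ _ hx hy => rw [lie_add]; exact add_mem hx hy
    | smul c a _ hx => rw [lie_smul]; exact Submodule.smul_mem _ _ hx

lemma span_reach_eq_top [LieModule.IsIrreducible ℂ g V] {Y : Set g} {v : V} (hv : v ≠ 0)
    (hY : ∀ x : g, x ∈ Submodule.span ℂ (Y ∪ {b | ∃ c : ℂ, ⁅b, v⁆ = c • v})) :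
    Submodule.span ℂ {w | Reach Y v w} = ⊤ := by
  let N : LieSubmodule ℂ g V :=
    { Submodule.span ℂ {w | Reach Y v w} with
      lie_mem := by
        intro x m hm
        change m ∈ Submodule.span ℂ {w | Reach Y v w} at hm
        change ⁅x, m⁆ ∈ Submodule.span ℂ {w | Reach Y v w}
        induction hm using Submodule.span_induction with
        | mem z hz => exact lie_span_reach hY z hz x
        | zero => simp
        | add x y _ _ hx hy => rw [lie_add]; exact add_mem hx hy
        | smul c x _ hx => rw [lie_smul]; exact Submodule.smul_mem _ _ hx }
  have hvN : v ∈ N := Submodule.subset_span (s := {w | Reach Y v w}) Reach.base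
  have hN : N = ⊤ := by
    rcases eq_bot_or_eq_top N with h | h
    · rw [h] at hvN
      exact absurd (by simpa using hvN) hv
    · exact h
  have := congrArg (fun M : LieSubmodule ℂ g V => (M : Submodule ℂ V)) hN
  simpa [N] using this

variable {P : Set (H → ℂ)} {Λ : H → ℂ} {v : V}

lemma triangular (hP : IsPos (rts H) P) (hv : Eig Λ v)
    (hpos : ∀ β ∈ P, ∀ x ∈ rootSpace H β, ⁅x, v⁆ = 0) (x : g) :
    x ∈ Submodule.span ℂ ({y : g | ∃ β ∈ P, y ∈ rootSpace H (-β)} ∪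
      {b | ∃ c : ℂ, ⁅b, v⁆ = c • v}) := by
  have htop := iSup_genWeightSpace_eq_top ℂ H g
  have htop' : ⨆ χ : H → ℂ, (genWeightSpace g χ).toSubmodule = ⊤ := by
    rw [← LieSubmodule.iSup_toSubmodule, htop, LieSubmodule.top_toSubmodule]
  have hx : x ∈ ⨆ χ : H → ℂ, (genWeightSpace g χ).toSubmodule := by rw [htop']; trivial
  revert x
  suffices ⨆ χ : H → ℂ, (genWeightSpace g χ).toSubmodule ≤
    Submodule.span ℂ ({y : g | ∃ β ∈ P, y ∈ rootSpace H (-β)} ∪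
      {b | ∃ c : ℂ, ⁅b, v⁆ = c • v}) from fun x hx => this hx
  refine iSup_le fun χ => ?_
  intro x hx
  apply Submodule.subset_span
  by_cases h0 : χ = 0
  · subst h0
    right
    have hxH : x ∈ H := by
      have h2 : x ∈ rootSpace H (0 : H → ℂ) := hx
      simpa using h2
    exact ⟨Λ ⟨x, hxH⟩, hv ⟨x, hxH⟩⟩
  by_cases hx0 : x = 0
  · right; exact ⟨0, by simp [hx0]⟩
  have hχ : χ ∈ rts H := ⟨h0, fun hb => hx0 (by
    have h2 : x ∈ rootSpace H χ := hx
    rw [hb] at h2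
    simpa using h2)⟩
  by_cases hp : χ ∈ P
  · right; exact ⟨0, by rw [hpos χ hp x hx, zero_smul]⟩
  · left
    refine ⟨-χ, ?_, by rw [neg_neg]; exact hx⟩
    by_contra hc
    exact hp ((hP.choice χ hχ).2 hc)

lemma reach_weight (hP : IsPos (rts H) P) (hv : Eig Λ v) {w : V}
    (hw : Reach {y : g | ∃ β ∈ P, y ∈ rootSpace H (-β)} v w) :
    ∃ q ∈ AddSubmonoid.closure P, Eig (Λ - q) w ∧ (q = 0 → w = v) := by
  induction hw with
  | base => exact ⟨0, zero_mem _, by simpa using hv, fun _ => rfl⟩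
  | step y w hy hw ih =>
    obtain ⟨β, hβ, hy⟩ := hy
    obtain ⟨q, hq, hqe, -⟩ := ih
    refine ⟨β + q, add_mem (AddSubmonoid.subset_closure hβ) hq, ?_, fun h0 => ?_⟩
    · have := hqe.lie hy
      convert this using 1
      abel
    · exact absurd (eq_zero_of_add hP (AddSubmonoid.subset_closure hβ) hq h0) (ne_zero_of_mem hP hβ)

lemma root_form [LieModule.IsIrreducible ℂ g V] (ω : V →ₗ[ℂ] V →ₗ[ℂ] g)
    (hω_alt : ∀ v : V, ω v v = 0)
    (hω : ∀ (x : g) (u v : V), ⁅x, ω u v⁆ = ω ⁅x, u⁆ v + ω u ⁅x, v⁆)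
    (hω_surj : Submodule.span ℂ {y : g | ∃ u v : V, ω u v = y} = ⊤)
    (hP : IsPos (rts H) P) (hv : Eig Λ v) (hv0 : v ≠ 0)
    (hpos : ∀ β ∈ P, ∀ x ∈ rootSpace H β, ⁅x, v⁆ = 0) {β : H → ℂ} (hβ : β ∈ rts H) :
    ∃ q ∈ AddSubmonoid.closure P, q ≠ 0 ∧ β + q = Λ + Λ := by
  by_contra hcon
  push Not at hcon
  have hspan := span_reach_eq_top hv0 (triangular hP hv hpos)
  set S := {w : V | Reach {y : g | ∃ β ∈ P, y ∈ rootSpace H (-β)} v w} with hS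
  let Z : Submodule ℂ g := ⨆ χ : H → ℂ, ⨆ _ : χ ≠ β, (genWeightSpace g χ).toSubmodule
  have hSS : ∀ a ∈ S, ∀ b ∈ S, ω a b ∈ Z := by
    intro a ha b hb
    obtain ⟨q, hq, hqa, hqv⟩ := reach_weight hP hv ha
    obtain ⟨r, hr, hrb, hrv⟩ := reach_weight hP hv hb
    by_cases h0 : q + r = 0
    · have hq0 := eq_zero_of_add hP hq hr h0
      have hr0 : r = 0 := by simpa [hq0] using h0
      rw [hqv hq0, hrv hr0, hω_alt]
      exact zero_mem _
    · have h1 := hcon (q + r) (add_mem hq hr) h0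
      have h2 : Eig (Λ - q + (Λ - r)) (ω a b) := hqa.omega ω hω hrb
      have h3 : Λ - q + (Λ - r) ≠ β := by
        intro h4
        apply h1
        rw [← h4]; abel
      exact Submodule.mem_iSup_of_mem _ (Submodule.mem_iSup_of_mem h3 h2.mem)
  have hall : ∀ a b : V, ω a b ∈ Z := by
    intro a b
    have ha : a ∈ Submodule.span ℂ S := by rw [hspan]; trivial
    have hb : b ∈ Submodule.span ℂ S := by rw [hspan]; trivial
    induction ha using Submodule.span_induction with
    | mem a ha =>
      induction hb using Submodule.span_induction with
      | mem b hb => exact hSS a ha b hb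
      | zero => simp
      | add x y _ _ hx hy => rw [map_add]; exact add_mem hx hy
      | smul c x _ hx => rw [map_smul]; exact Submodule.smul_mem _ _ hx
    | zero => simp
    | add x y _ _ hx hy => rw [map_add, LinearMap.add_apply]; exact add_mem hx hy
    | smul c x _ hx => rw [map_smul, LinearMap.smul_apply]; exact Submodule.smul_mem _ _ hx
  have hZ : Z = ⊤ := by
    rw [eq_top_iff, ← hω_surj, Submodule.span_le]
    rintro _ ⟨a, b, rfl⟩
    exact hall a b
  have hind := (LieSubmodule.iSupIndep_toSubmodule.2 (iSupIndep_genWeightSpace ℂ H g)) β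
  have hZ' : (⨆ χ : H → ℂ, ⨆ _ : χ ≠ β, (genWeightSpace g χ).toSubmodule) = ⊤ := hZ
  rw [hZ', disjoint_top] at hind
  exact hβ.2 (by simpa using hind)

lemma omega_ne_zero (ω : V →ₗ[ℂ] V →ₗ[ℂ] g)
    (hω_alt : ∀ v : V, ω v v = 0)
    (hω_surj : Submodule.span ℂ {y : g | ∃ u v : V, ω u v = y} = ⊤)
    (hω_dim : Module.finrank ℂ g = (Module.finrank ℂ V).choose 2)
    {u w : V} (h : LinearIndependent ℂ ![u, w]) : ω u w ≠ 0 := by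
  let φ : V [⋀^Fin 2]→ₗ[ℂ] g :=
    { toFun := fun x => ω (x 0) (x 1)
      map_update_add' := by
        intro _ m i x y
        fin_cases i <;> simp [Function.update]
      map_update_smul' := by
        intro _ m i c x
        fin_cases i <;> simp [Function.update]
      map_eq_zero_of_eq' := by
        intro x i j hij hne
        fin_cases i <;> fin_cases j <;> simp_all }
  let Φ := exteriorPower.alternatingMapLinearEquiv φ
  have hΦ : ∀ a b : V, Φ (exteriorPower.ιMulti ℂ 2 ![a, b]) = ω a b := by
    intro a b
    rw [exteriorPower.alternatingMapLinearEquiv_apply_ιMulti]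
    rfl
  have hsurj : Function.Surjective Φ := by
    rw [← LinearMap.range_eq_top, eq_top_iff, ← hω_surj, Submodule.span_le]
    rintro _ ⟨a, b, rfl⟩
    exact ⟨_, hΦ a b⟩
  have hinj : Function.Injective Φ := by
    refine (LinearMap.injective_iff_surjective_of_finrank_eq_finrank ?_).2 hsurj
    rw [exteriorPower.finrank_eq, hω_dim]
  rw [← hΦ]
  intro h0
  have h1 : exteriorPower.ιMulti ℂ 2 ![u, w] = 0 := hinj (by rw [h0, map_zero])
  obtain ⟨F, hF⟩ := LinearMap.exists_extend (h.repr : _ →ₗ[ℂ] (Fin 2 →₀ ℂ))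
  have hFi : ∀ i, F (![u, w] i) = Finsupp.single i 1 := by
    intro i
    have h2 := LinearMap.congr_fun hF ⟨![u, w] i, Submodule.subset_span ⟨i, rfl⟩⟩
    simp only [LinearMap.comp_apply, Submodule.subtype_apply] at h2
    rw [h2]
    exact h.repr_eq_single i _ rfl
  have h3 := exteriorPower.pairingDual_ιMulti_ιMulti
    (fun j : Fin 2 => (Finsupp.lapply j : (Fin 2 →₀ ℂ) →ₗ[ℂ] ℂ) ∘ₗ F) ![u, w]
  rw [h1, map_zero, Matrix.det_fin_two] at h3
  have hu := hFi 0
  have hw := hFi 1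
  simp at hu hw
  simp [hu, hw] at h3

lemma eig_lin_indep {μ ν : H → ℂ} (hne : μ ≠ ν) {u w : V} (hu : Eig μ u) (hw : Eig ν w)
    (hu0 : u ≠ 0) (hw0 : w ≠ 0) : LinearIndependent ℂ ![u, w] := by
  rw [LinearIndependent.pair_iff' hu0]
  rintro a rfl
  apply hne
  funext x
  have ha : a ≠ 0 := by rintro rfl; simp at hw0
  have h1 := hw x
  rw [lie_smul, hu x, smul_smul, smul_smul] at h1
  have := smul_left_injective ℂ hu0 h1
  rw [mul_comm] at this
  exact mul_right_cancel₀ ha this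

lemma Eig.smul_apply (hv : Eig Λ v) (hv0 : v ≠ 0) (c : ℂ) (x : H) : Λ (c • x) = c * Λ x := by
  have h1 := hv (c • x)
  have h2 : ((c • x : H) : g) = c • (x : g) := rfl
  rw [h2, smul_lie, hv x, smul_smul] at h1
  exact (smul_left_injective ℂ hv0 h1).symm

lemma Eig.add_apply (hv : Eig Λ v) (hv0 : v ≠ 0) (x y : H) : Λ (x + y) = Λ x + Λ y := by
  have h1 := hv (x + y)
  have h2 : ((x + y : H) : g) = (x : g) + (y : g) := rfl
  rw [h2, add_lie, hv x, hv y, ← add_smul] at h1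
  exact (smul_left_injective ℂ hv0 h1).symm

lemma exists_lower (hv : Eig Λ v) (hv0 : v ≠ 0) {β : H → ℂ} (hβ : β ∈ rts H)
    (hpos : ∀ x ∈ rootSpace H β, ⁅x, v⁆ = 0) (hne : Λ (tv β) ≠ 0) :
    ∃ f ∈ rootSpace H (-β), ⁅f, v⁆ ≠ 0 := by
  obtain ⟨χ, hχ, rfl⟩ := exists_weight hβ
  obtain ⟨h, e, f, ht, he, hf⟩ := IsKilling.exists_isSl2Triple_of_weight_isNonZero hχ
  refine ⟨f, hf, fun hfv => ?_⟩
  have h1 := ht.h_eq_coroot hχ he hf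
  have h2 : ⁅h, v⁆ = 0 := by
    rw [← ht.lie_e_f, lie_lie, hfv, hpos e he, lie_zero, lie_zero, sub_zero]
  rw [h1, hv, coroot_eq_tv, hv.smul_apply hv0] at h2
  have h3 := tv_self hβ
  simp [hv0, hne, h3] at h2

lemma lower_eq_zero (hv : Eig Λ v) (hv0 : v ≠ 0) {β : H → ℂ} (hβ : β ∈ rts H)
    (hpos : ∀ x ∈ rootSpace H β, ⁅x, v⁆ = 0) (hz : Λ (tv β) = 0) :
    ∀ f ∈ rootSpace H (-β), ⁅f, v⁆ = 0 := by
  obtain ⟨χ, hχ, rfl⟩ := exists_weight hβ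
  obtain ⟨h, e, f, ht, he, hf⟩ := IsKilling.exists_isSl2Triple_of_weight_isNonZero hχ
  have h1 := ht.h_eq_coroot hχ he hf
  have h2 : ⁅h, v⁆ = 0 := by
    rw [h1, hv, coroot_eq_tv, hv.smul_apply hv0, hz, mul_zero, zero_smul]
  have hfv : ⁅f, v⁆ = 0 := by
    by_contra hne
    have hprim : ht.HasPrimitiveVectorWith ⁅f, v⁆ (-2 : ℂ) :=
      { ne_zero := hne
        lie_h := by
          rw [leibniz_lie, h2, lie_zero, add_zero, ht.lie_lie_smul_f ℂ, neg_lie, smul_lie, neg_smul]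
        lie_e := by
          rw [leibniz_lie, ht.lie_e_f, h2, hpos e he, lie_zero, add_zero] }
    obtain ⟨n, hn⟩ := hprim.exists_nat
    have h5 : ((n + 2 : ℕ) : ℂ) = 0 := by push_cast; rw [← hn]; ring
    have : n + 2 = 0 := by exact_mod_cast h5
    omega
  intro y hy
  have hy' : y ∈ rootSpace H ((-χ : Weight ℂ H g) : H → ℂ) := by simpa using hy
  have hf' : f ∈ rootSpace H ((-χ : Weight ℂ H g) : H → ℂ) := by simpa using hf
  obtain ⟨c, hc⟩ := (finrank_eq_one_iff_of_nonzero' (⟨f, hf'⟩ : rootSpace H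
    ((-χ : Weight ℂ H g) : H → ℂ)) (by
      rw [ne_eq, LieSubmodule.mk_eq_zero]; exact ht.f_ne_zero)).mp
    (IsKilling.finrank_rootSpace_eq_one (-χ) (Weight.IsNonZero.neg hχ)) ⟨y, hy'⟩
  have hc' : c • f = y := congrArg Subtype.val hc
  rw [← hc', smul_lie, hfv, smul_zero]

lemma exists_active [LieModule.IsIrreducible ℂ g V]
    (hfaithful : ∀ x : g, (∀ v : V, ⁅x, v⁆ = 0) → x = 0)
    (hP : IsPos (rts H) P) (hv : Eig Λ v) (hv0 : v ≠ 0)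
    (hpos : ∀ β ∈ P, ∀ x ∈ rootSpace H β, ⁅x, v⁆ = 0) (s : LieIdeal ℂ g)
    {θ : H → ℂ} (hθ : θ ∈ rts H) (hθs : InS s θ) :
    ∃ β ∈ P, InS s β ∧ Λ (tv β) ≠ 0 := by
  by_contra hcon
  push Not at hcon
  have hzero : ∀ β ∈ rts H, InS s β → Λ (tv β) = 0 := by
    intro β hβ hs
    by_cases hp : β ∈ P
    · exact hcon β hp hs
    · have hn : -β ∈ P := by
        by_contra hc
        exact hp ((hP.choice β hβ).2 hc)
      have h1 := hcon (-β) hn (inS_neg s hβ hs)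
      have h2 : tv β = (-1 : ℂ) • tv (-β) := by rw [tv_neg hβ]; simp
      rw [h2, hv.smul_apply hv0, h1, mul_zero]
  have hroot : ∀ β ∈ rts H, InS s β → ∀ x ∈ rootSpace H β, ⁅x, v⁆ = 0 := by
    intro β hβ hs x hx
    by_cases hp : β ∈ P
    · exact hpos β hp x hx
    · have hn : -β ∈ P := by
        by_contra hc
        exact hp ((hP.choice β hβ).2 hc)
      exact lower_eq_zero hv hv0 (neg_mem_rts hβ) (hpos _ hn)
        (hzero _ (neg_mem_rts hβ) (inS_neg s hβ hs)) x (by rwa [neg_neg])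
  let A : Submodule ℂ g := LinearMap.ker ((toEnd ℂ g V : g →ₗ[ℂ] Module.End ℂ V).flip v)
  have hA : ∀ x, x ∈ A ↔ ⁅x, v⁆ = 0 := fun x => Iff.rfl
  have hsA : ∀ x ∈ s, ⁅x, v⁆ = 0 := by
    have h1 := LieIdeal.restr_eq_iSup_sl2SubmoduleOfRoot (H := H) s
    have h2 : (s.restr H).toSubmodule ≤ A := by
      rw [h1]
      simp only [LieSubmodule.iSup_toSubmodule]
      refine iSup₂_le fun α hα => ?_
      have hαr := weight_mem_rts (H.isNonZero_coe_root α)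
      have hαs : InS s ((α : Weight ℂ H g) : H → ℂ) := hα
      obtain ⟨h, e, f, ht, he, hf⟩ :=
        IsKilling.exists_isSl2Triple_of_weight_isNonZero (H.isNonZero_coe_root α)
      intro x hx
      obtain ⟨c₁, c₂, c₃, rfl⟩ :=
        (IsKilling.mem_sl2SubalgebraOfRoot_iff (H.isNonZero_coe_root α) ht he hf).mp hx
      have he0 := hroot _ hαr hαs e he
      have hf0 := hroot _ (neg_mem_rts hαr) (inS_neg s hαr hαs) f hf
      rw [hA]
      simp [he0, hf0]
    exact fun x hx => h2 hx
  let N : LieSubmodule ℂ g V :=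
    { carrier := {w | ∀ x ∈ s, ⁅x, w⁆ = 0}
      add_mem' := by
        intro a b ha hb x hx
        rw [lie_add, ha x hx, hb x hx, add_zero]
      zero_mem' := by intro x _; simp
      smul_mem' := by
        intro c a ha x hx
        rw [lie_smul, ha x hx, smul_zero]
      lie_mem := by
        intro y a ha x hx
        rw [leibniz_lie, ha x hx, lie_zero, add_zero]
        exact ha _ (lie_mem_left ℂ g s x y hx) }
  have hvN : v ∈ N := hsA
  have hN : N = ⊤ := by
    rcases eq_bot_or_eq_top N with h | h
    · rw [h] at hvN
      exact absurd (by simpa using hvN) hv0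
    · exact h
  apply hθ.2
  rw [LieSubmodule.eq_bot_iff]
  intro x hx
  apply hfaithful
  intro w
  have hw : w ∈ N := by rw [hN]; trivial
  exact hw x (hθs hx)

end Rep

end HighestRootAux


theorem highest_root_eq_two_highest_weight_sub_simple_root
    {g : Type*} [LieRing g] [LieAlgebra ℂ g] [FiniteDimensional ℂ g]
    [LieAlgebra.IsSemisimple ℂ g]
    (H : LieSubalgebra ℂ g) [H.IsCartanSubalgebra]
    {V : Type*} [AddCommGroup V] [Module ℂ V] [LieRingModule g V]
    [LieModule ℂ g V] [FiniteDimensional ℂ V] [LieModule.IsIrreducible ℂ g V]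
    -- faithfulness of V
    (hfaithful : ∀ x : g, (∀ v : V, ⁅x, v⁆ = 0) → x = 0)
    -- Λ²V ≅ adjoint representation of g, via the equivariant alternating map ω
    (ω : V →ₗ[ℂ] V →ₗ[ℂ] g)
    (hω_alt : ∀ v : V, ω v v = 0)
    (hω_equivariant : ∀ (x : g) (u v : V), ⁅x, ω u v⁆ = ω ⁅x, u⁆ v + ω u ⁅x, v⁆)
    (hω_surj : Submodule.span ℂ {y : g | ∃ u v : V, ω u v = y} = ⊤)
    (hω_dim : Module.finrank ℂ g = (Module.finrank ℂ V).choose 2)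
    -- a system of positive roots P for (g, H)
    (P : Set (H → ℂ))
    (hP_root : ∀ α ∈ P, α ≠ 0 ∧ rootSpace H α ≠ ⊥)
    (hP_choice : ∀ α : H → ℂ, α ≠ 0 → rootSpace H α ≠ ⊥ → (α ∈ P ↔ ¬(-α ∈ P)))
    (hP_add : ∀ α ∈ P, ∀ β ∈ P, rootSpace H (α + β) ≠ ⊥ → α + β ∈ P)
    -- Λ is the highest weight of V
    (Λ : H → ℂ)
    (hΛ_weight : genWeightSpace V Λ ≠ ⊥)
    (hΛ_highest : ∀ μ : H → ℂ, genWeightSpace V μ ≠ ⊥ →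
      Λ - μ ∈ AddSubmonoid.closure P)
    -- s is a simple ideal of g and θ is its highest root
    (s : LieIdeal ℂ g) (hs : LieAlgebra.IsSimple ℂ s)
    (θ : H → ℂ)
    (hθ_root : θ ≠ 0 ∧ rootSpace H θ ≠ ⊥)
    (hθ_in_s : (rootSpace H θ : Submodule ℂ g) ≤ (s : Submodule ℂ g))
    (hθ_highest : ∀ β : H → ℂ, β ≠ 0 → rootSpace H β ≠ ⊥ →
      (rootSpace H β : Submodule ℂ g) ≤ (s : Submodule ℂ g) →
      θ - β ∈ AddSubmonoid.closure P) :
    ∃ α ∈ P, (¬ ∃ β ∈ P, ∃ γ ∈ P, α = β + γ) ∧ θ + α = 2 • Λ := by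
  classical
  have hP : HighestRootAux.IsPos (HighestRootAux.rts H) P :=
    { cor := HighestRootAux.hasCoroots
      neg := fun _ h => HighestRootAux.neg_mem_rts h
      sub := hP_root
      choice := fun α h => hP_choice α h.1 h.2
      add := fun α hα β hβ h => hP_add α hα β hβ h.2 }
  have hfin : P.Finite := HighestRootAux.rts_finite.subset hP.sub
  obtain ⟨v, hv0, hv'⟩ := exists_forall_lie_eq_smul ℂ H V ⟨Λ, hΛ_weight⟩
  have hv : HighestRootAux.Eig Λ v := fun h => hv' h
  have hpos : ∀ β ∈ P, ∀ x ∈ rootSpace H β, ⁅x, v⁆ = 0 := by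
    intro β hβ x hx
    by_contra hne
    have h1 := (hv.lie hx).mem
    have h2 := hΛ_highest (β + Λ) (fun hb => hne (by
      rw [hb] at h1
      simpa using h1))
    have h3 := HighestRootAux.eq_zero_of_add hP (AddSubmonoid.subset_closure hβ) h2 (by abel)
    exact HighestRootAux.ne_zero_of_mem hP hβ h3
  have hform : ∀ β ∈ HighestRootAux.rts H,
      ∃ q ∈ AddSubmonoid.closure P, q ≠ 0 ∧ β + q = Λ + Λ := fun β hβ =>
    HighestRootAux.root_form ω hω_alt hω_equivariant hω_surj hP hv hv0 hpos hβ
  -- subtracting an active positive root from `2Λ` gives a root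
  have hroot : ∀ α ∈ P, Λ (HighestRootAux.tv α) ≠ 0 →
      Λ + Λ - α ∈ HighestRootAux.rts H := by
    intro α hα hact
    obtain ⟨f, hf, hfv⟩ := HighestRootAux.exists_lower hv hv0 (hP.sub hα) (hpos α hα) hact
    have he := hv.lie hf
    have hα0 := HighestRootAux.ne_zero_of_mem hP hα
    have hli := HighestRootAux.eig_lin_indep (by simpa using hα0) hv he hv0 hfv
    have hne := HighestRootAux.omega_ne_zero ω hω_alt hω_surj hω_dim hli
    have hw := (hv.omega ω hω_equivariant he).mem
    have heq : Λ + (-α + Λ) = Λ + Λ - α := by abel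
    rw [heq] at hw
    refine ⟨fun h0 => ?_, fun hb => hne ?_⟩
    · obtain ⟨q, -, hq0, hq⟩ := hform α (hP.sub hα)
      rw [← hq] at h0
      exact hq0 (by simpa using h0)
    · have hw' : ω v ⁅f, v⁆ ∈ rootSpace H (Λ + Λ - α) := hw
      rw [hb] at hw'
      simpa using hw'
  have hθ : θ ∈ HighestRootAux.rts H := hθ_root
  have hθs : HighestRootAux.InS s θ := hθ_in_s
  -- conclusion once `2Λ - α` lies in `s`
  have hfinish : ∀ α ∈ P, (¬ ∃ β ∈ P, ∃ γ ∈ P, α = β + γ) →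
      Λ + Λ - α ∈ HighestRootAux.rts H → HighestRootAux.InS s (Λ + Λ - α) →
      ∃ α ∈ P, (¬ ∃ β ∈ P, ∃ γ ∈ P, α = β + γ) ∧ θ + α = 2 • Λ := by
    intro α hα hs hr hin
    refine ⟨α, hα, hs, ?_⟩
    obtain ⟨q, hq, hq0, hqe⟩ := hform θ hθ
    have h1 := hθ_highest _ hr.1 hr.2 hin
    have h2 : α - q ∈ AddSubmonoid.closure P := by
      convert h1 using 1
      rw [← hqe]; abel
    rcases HighestRootAux.indecomposable hP hα hs hq h2 with h3 | h3
    · exact absurd h3 hq0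
    · rw [← h3, hqe, two_smul]
  obtain ⟨α, hα, hαs, hαin, hαact⟩ := HighestRootAux.exists_simple hP hfin
    (fun β => HighestRootAux.InS s β ∧ Λ (HighestRootAux.tv β) ≠ 0) (by
      rintro β hβ γ hγ hβγ ⟨h1, h2⟩
      have h3 := HighestRootAux.inS_of_add_left s (hP.sub hβ) (hP.sub hγ) (hP.sub hβγ) h1
      have h4 := HighestRootAux.inS_of_add_left s (hP.sub hγ) (hP.sub hβ)
        (by rw [add_comm]; exact hP.sub hβγ) (by rw [add_comm]; exact h1)
      rw [HighestRootAux.tv_add (hP.sub hβ) (hP.sub hγ), hv.add_apply hv0] at h2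
      by_cases h5 : Λ (HighestRootAux.tv β) = 0
      · right
        exact ⟨h4, by simpa [h5] using h2⟩
      · exact Or.inl ⟨h3, h5⟩)
    (HighestRootAux.exists_active hfaithful hP hv hv0 hpos s hθ hθs)
  have hβ := hroot α hα hαact
  by_cases hβs : HighestRootAux.InS s (Λ + Λ - α)
  · exact hfinish α hα hαs hβ hβs
  -- otherwise find a simple active root outside `s`
  obtain ⟨β, hβdef⟩ : ∃ β, β = Λ + Λ - α := ⟨_, rfl⟩
  rw [← hβdef] at hβ hβs
  have hβact : Λ (HighestRootAux.tv β) ≠ 0 := by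
    intro h0
    have h1 : β (HighestRootAux.tv β) = 0 := by
      have h2 : α (HighestRootAux.tv β) = 0 := by
        rw [HighestRootAux.tv_symm (hP.sub hα) hβ]
        exact HighestRootAux.vanish s hβs _ (HighestRootAux.tv_mem s (hP.sub hα) hαin)
      have h3 := congrFun hβdef (HighestRootAux.tv β)
      simpa [h0, h2] using h3
    exact HighestRootAux.tv_self hβ h1
  obtain ⟨α', hα', hα's, hα'in, hα'act⟩ := HighestRootAux.exists_simple hP hfin
    (fun β => ¬ HighestRootAux.InS s β ∧ Λ (HighestRootAux.tv β) ≠ 0) (by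
      rintro β hβ γ hγ hβγ ⟨h1, h2⟩
      have h3 := HighestRootAux.not_inS_of_add_left s (hP.sub hβ) (hP.sub hγ) (hP.sub hβγ) h1
      have h4 := HighestRootAux.not_inS_of_add_left s (hP.sub hγ) (hP.sub hβ)
        (by rw [add_comm]; exact hP.sub hβγ) (by rw [add_comm]; exact h1)
      rw [HighestRootAux.tv_add (hP.sub hβ) (hP.sub hγ), hv.add_apply hv0] at h2
      by_cases h5 : Λ (HighestRootAux.tv β) = 0
      · right
        exact ⟨h4, by simpa [h5] using h2⟩
      · exact Or.inl ⟨h3, h5⟩)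
    (by
      by_cases hp : β ∈ P
      · exact ⟨β, hp, hβs, hβact⟩
      · refine ⟨-β, ?_, ?_, ?_⟩
        · by_contra hc
          exact hp ((hP.choice β hβ).2 hc)
        · intro hc
          have := HighestRootAux.inS_neg s (HighestRootAux.neg_mem_rts hβ) hc
          rw [neg_neg] at this
          exact hβs this
        · have h2 : HighestRootAux.tv (-β) = (-1 : ℂ) • HighestRootAux.tv β := by
            rw [HighestRootAux.tv_neg hβ]; simp
          rw [h2, hv.smul_apply hv0]
          simpa using hβact)
  have hβ' := hroot α' hα' hα'act
  by_cases hβ's : HighestRootAux.InS s (Λ + Λ - α')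
  · exact hfinish α' hα' hα's hβ' hβ's
  exfalso
  refine HighestRootAux.not_both s (hP.sub hα) hαin fun x hx => ?_
  have h1 := HighestRootAux.vanish s hβs x hx
  have h2 := HighestRootAux.vanish s hβ's x hx
  have h3 := HighestRootAux.vanish s hα'in x hx
  rw [hβdef] at h1
  simp only [Pi.sub_apply, Pi.add_apply] at h1 h2
  rw [h3] at h2
  linear_combination h2 - h1
end
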